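/- Fix T ≥ 2 tasks with data distributions D_1,…,D_T on Z and, for each sample size m, i.i.d. samples S_j ∼ D_j^m of size m. Assume: (1) the hypothesis space H is a compact bounded subset of ℝ^d and P is the uniform probability measure on H; (2) ℓ(h,z) ∈ [0,K] and ℓ(·,z) is twice continuously differentiable in h; (3) for each i ∈ {1,…,T−1}, the function h ↦ L(h,D_i) has a unique global minimizer h*_i lying in the interior of H; (4) for every i ∈ {1,…,T−1} and every realization of the samples, the empirical task covariance cov_{h∼P}(e^{−√m L̂(h,S_i)}, e^{−√m Σ_{j=1, j≠i}^{T} L̂(h,S_j)}) is nonnegative. Let Q̂^{√m}_{1:T} be the T-fold iterated empirical Gibbs posterior with prior P, samples S_1,…,S_T, and common temperature √m. Then, provided the limits below exist, lim_{m→∞} (1/(T−1)) E_{S_1,…,S_T} Σ_{i=1}^{T−1} L(Q̂^{√m}_{1:T}, D_i) ≤ (1/(T−1)) Σ_{i=1}^{T−1} L(h*_i, D_i) + lim_{m→∞} (1/(2√m (T−1))) E_{S_1,…,S_T} Σ_{i=1}^{T−1} log det(∇²_h L̂(·,S_i)(h*_i)). -/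

import Mathlib

open MeasureTheory Real Filter

/-- Expected loss `L(h, D) = E_{z∼D} ℓ(h, z)`. -/
noncomputable def expLoss {H Z : Type*} [MeasurableSpace Z] (ℓ : H → Z → ℝ) (h : H)
    (D : Measure Z) : ℝ :=
  ∫ z, ℓ h z ∂D

/-- Empirical loss `L̂(h, S) = (1/m) ∑_{j=1}^m ℓ(h, z_j)`. -/
noncomputable def empLoss {H Z : Type*} (ℓ : H → Z → ℝ) {m : ℕ} (h : H) (S : Fin m → Z) : ℝ :=
  (∑ j, ℓ h (S j)) / m

/-- The measure with density with respect to `P` proportional to `e^{−g h}`. -/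
noncomputable def gibbs {H : Type*} [MeasurableSpace H] (P : Measure H) (g : H → ℝ) :
    Measure H :=
  P.withDensity fun h => ENNReal.ofReal (Real.exp (-g h) / ∫ h', Real.exp (-g h') ∂P)

/-- Iterated Gibbs updates: `iterGibbs P g n` applies the Gibbs update successively with the
loss functions `g 0, …, g (n−1)`, starting from the prior `P`. -/
noncomputable def iterGibbs {H : Type*} [MeasurableSpace H] (P : Measure H) (g : ℕ → H → ℝ) :
    ℕ → Measure H
  | 0 => P
  | n + 1 => gibbs (iterGibbs P g n) (g n)

/-- The determinant of the Hessian matrix of `f : ℝ^d → ℝ` at `x`. -/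
noncomputable def hessianDet {d : ℕ} (f : (Fin d → ℝ) → ℝ) (x : Fin d → ℝ) : ℝ :=
  Matrix.det (Matrix.of fun a b : Fin d =>
    iteratedFDeriv ℝ 2 f x ![Pi.single a 1, Pi.single b 1])


namespace Matrix.PosSemidef
variable {n : Type*} [Fintype n]

theorem sum_mulVec_eq_zero {ι : Type*} (s : Finset ι) {G : ι → Matrix n n ℝ}
    (hG : ∀ i ∈ s, (G i).PosSemidef) {v : n → ℝ} (hv : (∑ i ∈ s, G i) *ᵥ v = 0) :
    ∀ i ∈ s, G i *ᵥ v = 0 := by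
  have h : ∑ i ∈ s, star v ⬝ᵥ (G i *ᵥ v) = 0 := by
    rw [← dotProduct_sum, ← sum_mulVec, hv, dotProduct_zero]
  intro i hi
  rw [← (hG i hi).dotProduct_mulVec_zero_iff]
  exact (Finset.sum_eq_zero_iff_of_nonneg fun i hi =>
    (hG i hi).dotProduct_mulVec_nonneg v).1 h i hi

variable [DecidableEq n]

theorem one_le_det_one_add {C : Matrix n n ℝ} (hC : C.PosSemidef) : 1 ≤ (1 + C).det := by
  set U : Matrix n n ℝ := (hC.1.eigenvectorUnitary : Matrix n n ℝ) with hU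
  have hUU : star U * U = 1 := by simp [hU]
  have hUU' : U * star U = 1 := by simp [hU]
  have h : 1 + C = U * (1 + diagonal hC.1.eigenvalues) * star U := by
    have := hC.1.spectral_theorem
    rw [Unitary.conjStarAlgAut_apply] at this
    rw [mul_add, add_mul, mul_one, hUU']
    congr 1
  have hd : (1 : Matrix n n ℝ) + diagonal hC.1.eigenvalues =
      diagonal fun i => 1 + hC.1.eigenvalues i := by
    rw [← diagonal_one, diagonal_add]
  rw [h, det_mul_right_comm, hUU', one_mul, hd, det_diagonal]
  exact (Finset.prod_const_one (ι := n)).symm.le.trans (Finset.prod_le_prod (fun _ _ => zero_le_one)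
    fun i _ => by linarith [hC.eigenvalues_nonneg i])

theorem det_le_det_add {A B : Matrix n n ℝ} (hA : A.PosSemidef) (hB : B.PosSemidef) :
    A.det ≤ (A + B).det := by
  by_cases h0 : A.det = 0
  · rw [h0]; exact (hA.add hB).det_nonneg
  obtain ⟨R, rfl⟩ := by
    open scoped MatrixOrder in
    exact CStarAlgebra.nonneg_iff_eq_star_mul_self.mp hA.nonneg
  have hR : IsUnit R.det := by
    rw [isUnit_iff_ne_zero]; rintro h; apply h0; simp [h]
  have hRs : IsUnit (star R).det := by
    rw [isUnit_iff_ne_zero]; rintro h; apply h0; simp [h]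
  have hC := hB.conjTranspose_mul_mul_same R⁻¹
  have h : star R * R + B = star R * (1 + (R⁻¹)ᴴ * B * R⁻¹) * R := by
    rw [mul_add, add_mul, mul_one, conjTranspose_nonsing_inv, ← star_eq_conjTranspose]
    congr 1
    rw [mul_assoc (star R)⁻¹, mul_nonsing_inv_cancel_left _ _ hRs,
      nonsing_inv_mul_cancel_right _ _ hR]
  rw [h, det_mul_right_comm, det_mul (star R * R)]
  exact le_mul_of_one_le_right hA.det_nonneg hC.one_le_det_one_add

theorem det_add_ne_zero {A B : Matrix n n ℝ} (hA : A.PosSemidef) (hB : B.PosSemidef)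
    (h : A.det ≠ 0) : (A + B).det ≠ 0 :=
  ((lt_of_le_of_ne hA.det_nonneg (Ne.symm h)).trans_le (hA.det_le_det_add hB)).ne'

/-- In a nonsingular sum of positive semidefinite matrices, at most `card n` of the summands
cannot be omitted without making the sum singular. -/
theorem card_filter_det_sum_erase_le {ι : Type*} [Fintype ι] [DecidableEq ι]
    {G : ι → Matrix n n ℝ} (hG : ∀ i, (G i).PosSemidef) (h : (∑ i, G i).det ≠ 0) :
    (Finset.univ.filter fun j => (∑ i ∈ Finset.univ.erase j, G i).det = 0).card ≤
      Fintype.card n := by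
  set s := Finset.univ.filter fun j => (∑ i ∈ Finset.univ.erase j, G i).det = 0 with hs
  have hex : ∀ j : s, ∃ v : n → ℝ, v ≠ 0 ∧ ∀ i, i ≠ (j : ι) → G i *ᵥ v = 0 := by
    rintro ⟨j, hj⟩
    obtain ⟨v, hv, hv'⟩ := exists_mulVec_eq_zero_iff.2 (Finset.mem_filter.1 hj).2
    exact ⟨v, hv, fun i hi =>
      sum_mulVec_eq_zero _ (fun i _ => hG i) hv' i (Finset.mem_erase.2 ⟨hi, Finset.mem_univ _⟩)⟩
  choose v hv hv' using hex
  have hne : ∀ j : s, G j *ᵥ v j ≠ 0 := by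
    intro j hj
    refine h (exists_mulVec_eq_zero_iff.1 ⟨v j, hv j, ?_⟩)
    rw [sum_mulVec]
    refine Finset.sum_eq_zero fun i _ => ?_
    by_cases hij : i = (j : ι)
    · rw [hij, hj]
    · exact hv' j i hij
  have hli : LinearIndependent ℝ v := by
    rw [Fintype.linearIndependent_iff]
    intro c hc k
    have h1 : G k *ᵥ (∑ j, c j • v j) = c k • (G k *ᵥ v k) := by
      rw [mulVec_sum, Finset.sum_eq_single k]
      · rw [mulVec_smul]
      · intro j _ hjk
        rw [mulVec_smul, hv' j k (fun e => hjk (Subtype.ext e.symm)), smul_zero]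
      · simp
    rw [hc, mulVec_zero] at h1
    exact (smul_eq_zero.1 h1.symm).resolve_right (hne k)
  simpa using hli.fintype_card_le_finrank

end Matrix.PosSemidef

/-- The negative part of `log (det A)`, with the convention that it vanishes at singular `A`. -/
noncomputable def negLogDet {n : Type*} [Fintype n] [DecidableEq n] (A : Matrix n n ℝ) : ℝ :=
  max 0 (-Real.log A.det)

section
variable {n : Type*} [Fintype n] [DecidableEq n]

theorem negLogDet_nonneg (A : Matrix n n ℝ) : 0 ≤ negLogDet A := le_max_left _ _

theorem negLogDet_of_det_eq_zero {A : Matrix n n ℝ} (h : A.det = 0) : negLogDet A = 0 := by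
  simp [negLogDet, h]

theorem negLogDet_add_le {A B : Matrix n n ℝ} (hA : A.PosSemidef) (hB : B.PosSemidef)
    (h : A.det ≠ 0) : negLogDet (A + B) ≤ negLogDet A := by
  unfold negLogDet
  have := Real.log_le_log (lt_of_le_of_ne hA.det_nonneg (Ne.symm h)) (hA.det_le_det_add hB)
  exact max_le_max le_rfl (by linarith)

theorem card_mul_negLogDet_sum_le {r : ℕ} (hr : Fintype.card n < r + 1)
    {G : Fin (r + 1) → Matrix n n ℝ} (hG : ∀ i, (G i).PosSemidef) :
    (r + 1 : ℝ) * negLogDet (∑ i, G i) ≤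
      ∑ j, negLogDet (∑ i, G (j.succAbove i)) * (1 + (Fintype.card n / (r + 1 - Fintype.card n) : ℝ) *
        (if (G j).det = 0 then 1 else 0)) := by
  have hr' : (0 : ℝ) < r + 1 - Fintype.card n := by
    have : ((Fintype.card n : ℕ) : ℝ) < ((r + 1 : ℕ) : ℝ) := by exact_mod_cast hr
    push_cast at this; linarith
  set κ : ℝ := (Fintype.card n / (r + 1 - Fintype.card n) : ℝ) with hκ
  have hκ0 : 0 ≤ κ := by positivity
  have hpos : ∀ j : Fin (r + 1), (∑ i, G (j.succAbove i)).PosSemidef := fun j =>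
    Matrix.posSemidef_sum _ fun i _ => hG _
  have hterm : ∀ j, 0 ≤ negLogDet (∑ i, G (j.succAbove i)) *
      (1 + κ * (if (G j).det = 0 then 1 else 0)) := fun j =>
    mul_nonneg (negLogDet_nonneg _) (by split_ifs <;> simp; positivity)
  by_cases h : (∑ i, G i).det = 0
  · rw [negLogDet_of_det_eq_zero h, mul_zero]
    exact Finset.sum_nonneg fun j _ => hterm j
  set x := negLogDet (∑ i, G i) with hx
  have hx0 : 0 ≤ x := negLogDet_nonneg _
  have hsum : ∀ j, ∑ i, G i = ∑ i, G (j.succAbove i) + G j := fun j => by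
    rw [Fin.sum_univ_succAbove _ j, add_comm]
  have hle : ∀ j : Fin (r + 1), (∑ i, G (j.succAbove i)).det ≠ 0 →
      x ≤ negLogDet (∑ i, G (j.succAbove i)) :=
    fun j hj => by
      rw [hx, hsum j]; exact negLogDet_add_le (hpos j) (hG j) hj
  by_cases hall : ∀ j : Fin (r + 1), (∑ i, G (j.succAbove i)).det ≠ 0
  · calc (r + 1 : ℝ) * x = ∑ _j : Fin (r + 1), x := by simp
      _ ≤ _ := Finset.sum_le_sum fun j _ => by
        have h1 : (1 : ℝ) ≤ 1 + κ * (if (G j).det = 0 then 1 else 0) := by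
          split_ifs <;> simp; positivity
        calc x = x * 1 := (mul_one x).symm
          _ ≤ _ := mul_le_mul (hle j (hall j)) h1 zero_le_one (negLogDet_nonneg _)
  push Not at hall
  obtain ⟨j₀, hj₀⟩ := hall
  have hsing : ∀ j : Fin (r + 1), (∑ i, G (j.succAbove i)).det ≠ 0 → (G j).det = 0 := by
    intro j hj
    by_contra hne
    have hjj : j ≠ j₀ := fun e => hj (e ▸ hj₀)
    obtain ⟨k, rfl⟩ := Fin.exists_succAbove_eq hjj
    have hk := Finset.add_sum_erase Finset.univ (fun i => G (j₀.succAbove i)) (Finset.mem_univ k)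
    rw [← hk] at hj₀
    exact Matrix.PosSemidef.det_add_ne_zero (hG _)
      (Matrix.posSemidef_sum _ fun i _ => hG _) hne hj₀
  set N := Finset.univ.filter fun j : Fin (r + 1) => (∑ i, G (j.succAbove i)).det ≠ 0 with hN
  have hcard : (r + 1 - Fintype.card n : ℝ) ≤ N.card := by
    have h1 := Matrix.PosSemidef.card_filter_det_sum_erase_le hG h
    have h2 : (Finset.univ.filter fun j => (∑ i ∈ Finset.univ.erase j, G i).det = 0) =
        Finset.univ.filter fun j : Fin (r + 1) => ¬ (∑ i, G (j.succAbove i)).det ≠ 0 := by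
      ext j
      have : ∑ i ∈ Finset.univ.erase j, G i = ∑ i, G (j.succAbove i) := by
        have := Finset.add_sum_erase Finset.univ G (Finset.mem_univ j)
        rw [hsum j, add_comm] at this
        exact add_right_cancel this
      simp only [Finset.mem_filter, Finset.mem_univ, true_and, this, not_not]
    rw [h2] at h1
    have h3 := Finset.card_filter_add_card_filter_not (s := Finset.univ)
      (fun j : Fin (r + 1) => (∑ i, G (j.succAbove i)).det ≠ 0)
    rw [Finset.card_univ, Fintype.card_fin] at h3
    have h4 : (r + 1 : ℕ) ≤ N.card + Fintype.card n := by rw [hN]; omega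
    have : ((r + 1 : ℕ) : ℝ) ≤ ((N.card + Fintype.card n : ℕ) : ℝ) := by exact_mod_cast h4
    push_cast at this; linarith
  have hκ1 : (r + 1 - Fintype.card n : ℝ) * (1 + κ) = r + 1 := by
    rw [hκ]; field_simp; ring
  calc (r + 1 : ℝ) * x = (r + 1 - Fintype.card n : ℝ) * ((1 + κ) * x) := by rw [← mul_assoc, hκ1]
    _ ≤ N.card * ((1 + κ) * x) := by gcongr
    _ = ∑ _j ∈ N, x * (1 + κ) := by rw [Finset.sum_const, nsmul_eq_mul]; ring
    _ ≤ ∑ j ∈ N, negLogDet (∑ i, G (j.succAbove i)) *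
        (1 + κ * (if (G j).det = 0 then 1 else 0)) := Finset.sum_le_sum fun j hj => by
        have hj' := (Finset.mem_filter.1 hj).2
        rw [if_pos (hsing j hj'), mul_one]
        gcongr
        exact hle j hj'
    _ ≤ _ := Finset.sum_le_sum_of_subset_of_nonneg (Finset.subset_univ _) fun j _ _ => hterm j

end

theorem measurable_det_of_entries {Z n : Type*} [MeasurableSpace Z] [Fintype n] [DecidableEq n]
    {A : Z → Matrix n n ℝ} (hA : ∀ a b, Measurable fun z => A z a b) :
    Measurable fun z => (A z).det := by
  simp only [Matrix.det_apply]
  fun_prop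

theorem measurable_sum_entries {Z n : Type*} [MeasurableSpace Z]
    {A : Z → Matrix n n ℝ} (hA : ∀ a b, Measurable fun z => A z a b)
    (ι : Type*) [Fintype ι] (a b : n) :
    Measurable fun ω : ι → Z => (∑ i, A (ω i)) a b := by
  simp only [Matrix.sum_apply]
  exact Finset.measurable_sum _ fun i _ => (hA a b).comp (measurable_pi_apply i)

theorem sum_blocks {Z n : Type*} (A : Z → Matrix n n ℝ) {r k : ℕ} (ω : Fin (r * k) → Z) :
    ∑ i, A (ω i) = ∑ i : Fin r, ∑ j : Fin k, A (ω (finProdFinEquiv (i, j))) := by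
  rw [← finProdFinEquiv.sum_comp, Fintype.sum_prod_type]

section
variable {Z n : Type*} [MeasurableSpace Z] [Fintype n] [DecidableEq n]

theorem measurable_negLogDet {A : Z → Matrix n n ℝ} (hA : ∀ a b, Measurable fun z => A z a b) :
    Measurable fun z => negLogDet (A z) :=
  measurable_const.max (Real.measurable_log.comp (measurable_det_of_entries hA)).neg

/-- The expected negative part of the log-determinant of a sum of `r` i.i.d. random matrices. -/
noncomputable def expNegLogDet (μ : Measure Z) (A : Z → Matrix n n ℝ) (r : ℕ) : ENNReal :=
  ∫⁻ ω, ENNReal.ofReal (negLogDet (∑ i, A (ω i))) ∂(Measure.pi fun _ : Fin r => μ)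

theorem expNegLogDet_succ_le {μ : Measure Z} [IsProbabilityMeasure μ] {A : Z → Matrix n n ℝ}
    (hA : ∀ a b, Measurable fun z => A z a b) (hpos : ∀ z, (A z).PosSemidef) {r : ℕ}
    (hr : Fintype.card n < r + 1) :
    expNegLogDet μ A (r + 1) ≤ ENNReal.ofReal
      (1 + (Fintype.card n / (r + 1 - Fintype.card n) : ℝ) * μ.real {z | (A z).det = 0}) *
        expNegLogDet μ A r := by
  have hr' : (0 : ℝ) < r + 1 - Fintype.card n := by
    have : ((Fintype.card n : ℕ) : ℝ) < ((r + 1 : ℕ) : ℝ) := by exact_mod_cast hr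
    push_cast at this; linarith
  set κ : ℝ := (Fintype.card n / (r + 1 - Fintype.card n) : ℝ) with hκ
  have hκ0 : 0 ≤ κ := by positivity
  have hmS : MeasurableSet {z | (A z).det = 0} :=
    measurable_det_of_entries hA (measurableSet_singleton 0)
  set w : Z → ℝ := fun z => 1 + κ * (if (A z).det = 0 then 1 else 0) with hw
  have hwm : Measurable w :=
    measurable_const.add (measurable_const.mul
      (Measurable.ite hmS measurable_const measurable_const))
  have hw0 : ∀ z, 0 ≤ w z := fun z => by
    simp only [hw]; split_ifs
    · positivity
    · norm_num
  have hwint : ∫⁻ z, ENNReal.ofReal (w z) ∂μ =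
      ENNReal.ofReal (1 + κ * μ.real {z | (A z).det = 0}) := by
    have hind : (fun z => if (A z).det = 0 then (1 : ℝ) else 0) =
        {z | (A z).det = 0}.indicator 1 := by
      ext z; simp [Set.indicator_apply]
    have hi : Integrable (fun z => if (A z).det = 0 then (1 : ℝ) else 0) μ := by
      rw [hind]; exact (integrable_const (1 : ℝ)).indicator hmS
    rw [← ofReal_integral_eq_lintegral_ofReal (f := w)
      ((integrable_const _).add (hi.const_mul κ)) (ae_of_all _ hw0),
      integral_add (integrable_const _) (hi.const_mul κ), integral_const_mul,
      hind, integral_indicator_one hmS]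
    simp
  have hmN : ∀ k : ℕ, Measurable fun ω : Fin k → Z =>
      ENNReal.ofReal (negLogDet (∑ i, A (ω i))) := fun k =>
    (measurable_negLogDet (measurable_sum_entries hA (Fin k))).ennreal_ofReal
  have hterm : ∀ j : Fin (r + 1),
      ∫⁻ ω, ENNReal.ofReal (negLogDet (∑ i, A (ω (j.succAbove i)))) * ENNReal.ofReal (w (ω j))
        ∂(Measure.pi fun _ : Fin (r + 1) => μ) =
      ENNReal.ofReal (1 + κ * μ.real {z | (A z).det = 0}) * expNegLogDet μ A r := by
    intro j
    have hmp := measurePreserving_piFinSuccAbove (fun _ : Fin (r + 1) => μ) j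
    have h1 := hmp.lintegral_comp (f := fun p : Z × (Fin r → Z) =>
      ENNReal.ofReal (w p.1) * ENNReal.ofReal (negLogDet (∑ i, A (p.2 i))))
      ((hwm.ennreal_ofReal.comp measurable_fst).mul ((hmN r).comp measurable_snd))
    rw [lintegral_prod_mul hwm.ennreal_ofReal.aemeasurable (hmN r).aemeasurable, hwint] at h1
    rw [expNegLogDet, ← h1]
    exact lintegral_congr fun ω => mul_comm _ _
  have hmul : ((r + 1 : ℕ) : ENNReal) * expNegLogDet μ A (r + 1) ≤ ((r + 1 : ℕ) : ENNReal) *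
      (ENNReal.ofReal (1 + κ * μ.real {z | (A z).det = 0}) * expNegLogDet μ A r) := by
    calc ((r + 1 : ℕ) : ENNReal) * expNegLogDet μ A (r + 1)
        = ∫⁻ ω, ENNReal.ofReal ((r + 1 : ℝ) * negLogDet (∑ i, A (ω i)))
          ∂(Measure.pi fun _ : Fin (r + 1) => μ) := by
          rw [expNegLogDet, ← lintegral_const_mul _ (hmN _)]
          refine lintegral_congr fun ω => ?_
          rw [ENNReal.ofReal_mul (by positivity)]
          congr 1
          rw [← ENNReal.ofReal_natCast]; push_cast; rfl
      _ ≤ ∫⁻ ω, ∑ j : Fin (r + 1), ENNReal.ofReal (negLogDet (∑ i, A (ω (j.succAbove i)))) *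
          ENNReal.ofReal (w (ω j)) ∂(Measure.pi fun _ : Fin (r + 1) => μ) := by
          refine lintegral_mono fun ω => ?_
          refine (ENNReal.ofReal_le_ofReal
            (card_mul_negLogDet_sum_le hr fun i => hpos (ω i))).trans ?_
          rw [ENNReal.ofReal_sum_of_nonneg fun j _ => mul_nonneg (negLogDet_nonneg _) (hw0 (ω j))]
          exact Finset.sum_le_sum fun j _ => (ENNReal.ofReal_mul (negLogDet_nonneg _)).le
      _ = _ := by
          rw [lintegral_finsetSum]
          · simp_rw [hterm]
            simp
          · intro j _
            exact ((hmN r).comp (measurable_pi_lambda _ fun i => measurable_pi_apply _)).mul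
              (hwm.ennreal_ofReal.comp (measurable_pi_apply j))
  exact (ENNReal.mul_le_mul_iff_right (by simp) (by simp)).1 hmul

theorem tendsto_expNegLogDet_div_sqrt {μ : Measure Z} [IsProbabilityMeasure μ]
    {A : Z → Matrix n n ℝ} (hA : ∀ a b, Measurable fun z => A z a b)
    (hpos : ∀ z, (A z).PosSemidef)
    (hq : Fintype.card n * μ.real {z | (A z).det = 0} ≤ 1 / 4)
    (hfin : ∀ᶠ r in atTop, expNegLogDet μ A r ≠ ⊤) :
    Tendsto (fun r : ℕ => (expNegLogDet μ A r).toReal / √r) atTop (nhds 0) := by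
  obtain ⟨r₀, hr₀⟩ := (hfin.and (eventually_ge_atTop (Fintype.card n + 1))).exists_forall_of_atTop
  set u : ℕ → ℝ := fun r => (expNegLogDet μ A r).toReal with hu
  have hu0 : ∀ r, 0 ≤ u r := fun r => ENNReal.toReal_nonneg
  have hstep : ∀ r, r₀ ≤ r → u (r + 1) ≤ (1 + 1 / (4 * (r + 1 - Fintype.card n : ℝ))) * u r := by
    intro r hr
    have hrn : Fintype.card n < r + 1 := by have := (hr₀ r hr).2; omega
    have hr' : (0 : ℝ) < r + 1 - Fintype.card n := by
      have : ((Fintype.card n : ℕ) : ℝ) < ((r + 1 : ℕ) : ℝ) := by exact_mod_cast hrn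
      push_cast at this; linarith
    have h1 := ENNReal.toReal_mono (ENNReal.mul_ne_top ENNReal.ofReal_ne_top (hr₀ r hr).1)
      (expNegLogDet_succ_le hA hpos hrn)
    rw [ENNReal.toReal_mul, ENNReal.toReal_ofReal (by positivity)] at h1
    refine h1.trans (mul_le_mul_of_nonneg_right ?_ (hu0 r))
    have : (Fintype.card n / (r + 1 - Fintype.card n) : ℝ) * μ.real {z | (A z).det = 0} =
        (Fintype.card n * μ.real {z | (A z).det = 0}) / (r + 1 - Fintype.card n) := by ring
    rw [this, show (1 : ℝ) / (4 * (r + 1 - Fintype.card n)) = (1 / 4) / (r + 1 - Fintype.card n) by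
      field_simp]
    gcongr
  have hcube : ∀ r, r₀ ≤ r → u r ^ 3 ≤ u r₀ ^ 3 * (r + 1 - Fintype.card n) := by
    intro r hr
    induction r, hr using Nat.le_induction with
    | base =>
      have : ((Fintype.card n + 1 : ℕ) : ℝ) ≤ (r₀ : ℝ) := by exact_mod_cast (hr₀ r₀ le_rfl).2
      push_cast at this
      exact le_mul_of_one_le_right (pow_nonneg (hu0 _) 3) (by linarith)
    | succ r hr ih =>
      have hx : (1 : ℝ) ≤ r + 1 - Fintype.card n := by
        have : ((Fintype.card n + 1 : ℕ) : ℝ) ≤ (r : ℝ) := by exact_mod_cast (hr₀ r hr).2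
        push_cast at this; linarith
      push_cast
      set x : ℝ := r + 1 - Fintype.card n with hxdef
      have hx0 : 0 < x := by linarith
      have hpoly : (1 + 1 / (4 * x)) ^ 3 * x ≤ x + 1 := by
        have h1 : 1 / (4 * x) * x = 1 / 4 := by field_simp
        have h2 : 1 / (4 * x) ≤ 1 / 4 := by
          rw [div_le_div_iff₀ (by positivity) (by norm_num)]; linarith
        have h3 : 0 ≤ 1 / (4 * x) := by positivity
        set t := 1 / (4 * x)
        have : (1 + t) ^ 3 * x = x + 3 * (t * x) + 3 * t * (t * x) + t ^ 2 * (t * x) := by ring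
        rw [this, h1]
        nlinarith
      calc u (r + 1) ^ 3 ≤ ((1 + 1 / (4 * x)) * u r) ^ 3 := by
            exact pow_le_pow_left₀ (hu0 _) (hstep r hr) 3
        _ = (1 + 1 / (4 * x)) ^ 3 * u r ^ 3 := by ring
        _ ≤ (1 + 1 / (4 * x)) ^ 3 * (u r₀ ^ 3 * x) := by gcongr
        _ = u r₀ ^ 3 * ((1 + 1 / (4 * x)) ^ 3 * x) := by ring
        _ ≤ u r₀ ^ 3 * (x + 1) := by
            gcongr
        _ = u r₀ ^ 3 * ((r : ℝ) + 1 + 1 - Fintype.card n) := by rw [hxdef]; ring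
  have hsqrt : Tendsto (fun r : ℕ => √(r : ℝ)) atTop atTop :=
    tendsto_sqrt_atTop.comp tendsto_natCast_atTop_atTop
  have hlim : Tendsto (fun r : ℕ => (u r / √r) ^ 3) atTop (nhds 0) := by
    have hb : Tendsto (fun r : ℕ => 2 * u r₀ ^ 3 / √r) atTop (nhds 0) :=
      hsqrt.const_div_atTop _
    refine squeeze_zero' (Eventually.of_forall fun r => by have := hu0 r; positivity) ?_ hb
    filter_upwards [eventually_ge_atTop r₀, eventually_ge_atTop 1] with r hr hr1
    have hr1' : (1 : ℝ) ≤ r := by exact_mod_cast hr1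
    have hs : 0 < √(r : ℝ) := Real.sqrt_pos.2 (by linarith)
    have hss : √(r : ℝ) ^ 2 = r := Real.sq_sqrt (by linarith)
    rw [div_pow, div_le_div_iff₀ (by positivity) hs]
    have h1 : u r ^ 3 ≤ u r₀ ^ 3 * (2 * r) := (hcube r hr).trans (by
      have := hu0 r₀
      gcongr
      have : (0 : ℝ) ≤ Fintype.card n := by positivity
      linarith)
    calc u r ^ 3 * √(r : ℝ) ≤ u r₀ ^ 3 * (2 * r) * √(r : ℝ) := by gcongr
      _ = 2 * u r₀ ^ 3 * (√(r : ℝ) ^ 2 * √(r : ℝ)) := by rw [hss]; ring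
      _ = _ := by ring
  have := hlim.rpow_const (p := ((3 : ℕ) : ℝ)⁻¹) (Or.inr (by positivity))
  rw [Real.zero_rpow (by norm_num)] at this
  refine this.congr fun r => ?_
  exact Real.pow_rpow_inv_natCast (by have := hu0 r; positivity) (by norm_num)

theorem measurePreserving_blocks (μ : Measure Z) [IsProbabilityMeasure μ] (r k : ℕ) :
    MeasurePreserving (fun (ω : Fin (r * k) → Z) (i : Fin r) (j : Fin k) =>
        ω (finProdFinEquiv (i, j))) (Measure.pi fun _ => μ)
      (Measure.pi fun _ : Fin r => Measure.pi fun _ : Fin k => μ) := by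
  have h1 := (measurePreserving_piCongrLeft (fun _ : Fin (r * k) => μ)
    (finProdFinEquiv (m := r) (n := k))).symm
  have h2 : MeasurePreserving (MeasurableEquiv.curry (Fin r) (Fin k) Z)
      (Measure.pi fun _ => μ) (Measure.pi fun _ : Fin r => Measure.pi fun _ : Fin k => μ) := by
    refine ⟨(MeasurableEquiv.curry _ _ _).measurable, ?_⟩
    have := Measure.infinitePi_map_curry (fun (_ : Fin r) (_ : Fin k) => μ)
    simpa only [Measure.infinitePi_eq_pi] using this
  exact h2.comp h1

theorem expNegLogDet_mul {μ : Measure Z} [IsProbabilityMeasure μ] {A : Z → Matrix n n ℝ}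
    (hA : ∀ a b, Measurable fun z => A z a b) (r k : ℕ) :
    expNegLogDet μ A (r * k) =
      expNegLogDet (Measure.pi fun _ : Fin k => μ) (fun ω => ∑ j, A (ω j)) r := by
  unfold expNegLogDet
  rw [← (measurePreserving_blocks μ r k).lintegral_comp
    (measurable_negLogDet (measurable_sum_entries (measurable_sum_entries hA _) _)).ennreal_ofReal]
  exact lintegral_congr fun ω => by rw [sum_blocks]

theorem measure_det_sum_mul_le {μ : Measure Z} [IsProbabilityMeasure μ] {A : Z → Matrix n n ℝ}
    (hA : ∀ a b, Measurable fun z => A z a b) (hpos : ∀ z, (A z).PosSemidef) (r k : ℕ) :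
    (Measure.pi fun _ : Fin (r * k) => μ) {ω | (∑ i, A (ω i)).det = 0} ≤
      (Measure.pi fun _ : Fin k => μ) {ω | (∑ i, A (ω i)).det = 0} ^ r := by
  set S : Set (Fin k → Z) := {ω | (∑ i, A (ω i)).det = 0} with hS
  have hSm : MeasurableSet S :=
    measurable_det_of_entries (measurable_sum_entries hA _) (measurableSet_singleton 0)
  have h := (measurePreserving_blocks μ r k).measure_preimage
    (MeasurableSet.univ_pi fun _ : Fin r => hSm).nullMeasurableSet
  rw [Measure.pi_pi, Finset.prod_const, Finset.card_univ, Fintype.card_fin] at h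
  rw [← h]
  refine measure_mono fun ω hω i _ => ?_
  by_contra hne
  refine absurd hω ?_
  rw [Set.mem_ofPred_eq, sum_blocks, ← Finset.add_sum_erase _ _ (Finset.mem_univ i)]
  exact Matrix.PosSemidef.det_add_ne_zero (Matrix.posSemidef_sum _ fun j _ => hpos _)
    (Matrix.posSemidef_sum _ fun _ _ => Matrix.posSemidef_sum _ fun j _ => hpos _) hne

theorem exists_tendsto_expNegLogDet_mul_div_sqrt {μ : Measure Z} [IsProbabilityMeasure μ]
    {A : Z → Matrix n n ℝ} (hA : ∀ a b, Measurable fun z => A z a b)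
    (hpos : ∀ z, (A z).PosSemidef) (hfin : ∀ᶠ r in atTop, expNegLogDet μ A r ≠ ⊤) :
    ∃ k₀ : ℕ, 0 < k₀ ∧ ∀ k, 0 < k → k₀ ∣ k →
      Tendsto (fun r : ℕ => (expNegLogDet μ A (r * k)).toReal / √r) atTop (nhds 0) := by
  by_cases hdeg : ∀ k, 0 < k →
      (Measure.pi fun _ : Fin k => μ) {ω | (∑ i, A (ω i)).det = 0} = 1
  · refine ⟨1, one_pos, fun k hk _ => ?_⟩
    refine tendsto_const_nhds.congr' ?_
    filter_upwards [eventually_gt_atTop 0] with r hr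
    have h : ∀ᵐ ω ∂(Measure.pi fun _ : Fin (r * k) => μ), (∑ i, A (ω i)).det = 0 :=
      (prob_compl_eq_zero_iff (measurable_det_of_entries (measurable_sum_entries hA _)
        (measurableSet_singleton 0))).2 (hdeg _ (by positivity))
    have h0 : expNegLogDet μ A (r * k) = 0 :=
      (lintegral_congr_ae (h.mono fun ω hω => by
        rw [negLogDet_of_det_eq_zero hω, ENNReal.ofReal_zero])).trans lintegral_zero
    simp [h0]
  push Not at hdeg
  obtain ⟨k₁, hk₁, hne⟩ := hdeg
  set q := (Measure.pi fun _ : Fin k₁ => μ) {ω | (∑ i, A (ω i)).det = 0} with hq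
  have hq1 : q < 1 := lt_of_le_of_ne prob_le_one hne
  have hlim : Tendsto (fun N : ℕ => (Fintype.card n : ENNReal) * q ^ N) atTop (nhds 0) := by
    simpa using ENNReal.Tendsto.const_mul (ENNReal.tendsto_pow_atTop_nhds_zero_of_lt_one hq1)
      (Or.inr (ENNReal.natCast_ne_top (Fintype.card n)))
  obtain ⟨N, hN, hN0⟩ := ((hlim.eventually (Iio_mem_nhds
    (show (0 : ENNReal) < ENNReal.ofReal (1 / 4) by simp))).and (eventually_gt_atTop 0)).exists
  refine ⟨N * k₁, by positivity, fun k hk hdvd => ?_⟩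
  obtain ⟨c, rfl⟩ := hdvd
  have hc : 0 < c := Nat.pos_of_mul_pos_left hk
  simp_rw [expNegLogDet_mul hA]
  refine tendsto_expNegLogDet_div_sqrt (measurable_sum_entries hA _)
    (fun ω => Matrix.posSemidef_sum _ fun j _ => hpos _) ?_ ?_
  · have h1 : (Measure.pi fun _ : Fin (N * k₁ * c) => μ) {ω | (∑ i, A (ω i)).det = 0} ≤ q ^ N := by
      have := measure_det_sum_mul_le (μ := μ) hA hpos (c * N) k₁
      rw [show N * k₁ * c = c * N * k₁ by ring]
      exact this.trans (pow_le_pow_right_of_le_one' hq1.le (Nat.le_mul_of_pos_left N hc))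
    have h2 : (Fintype.card n : ENNReal) *
        (Measure.pi fun _ : Fin (N * k₁ * c) => μ) {ω | (∑ i, A (ω i)).det = 0} ≤
          ENNReal.ofReal (1 / 4) := (mul_le_mul_right h1 _).trans (le_of_lt hN)
    have h3 := ENNReal.toReal_mono ENNReal.ofReal_ne_top h2
    rw [ENNReal.toReal_mul, ENNReal.toReal_ofReal (by norm_num), ENNReal.toReal_natCast] at h3
    exact h3
  · have ht : Tendsto (fun r => r * (N * k₁ * c)) atTop atTop :=
      tendsto_id.atTop_mul_const' hk
    filter_upwards [ht.eventually hfin] with r hr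
    rwa [← expNegLogDet_mul hA]

end

section
variable {E : Type*} [NormedAddCommGroup E] [NormedSpace ℝ E] {f : E → ℝ}

theorem hasDerivAt_comp_line {F : Type*} [NormedAddCommGroup F] [NormedSpace ℝ F] {g : E → F}
    (hg : Differentiable ℝ g) (x v : E) (t : ℝ) :
    HasDerivAt (fun s : ℝ => g (x + s • v)) (fderiv ℝ g (x + t • v) v) t := by
  have h1 : HasDerivAt (fun s : ℝ => x + s • v) v t := by
    simpa using ((hasDerivAt_id t).smul_const v).const_add x
  exact (hg _).hasFDerivAt.comp_hasDerivAt t h1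

theorem fderiv_fderiv_apply_self_nonneg_of_isLocalMin (hf : ContDiff ℝ 2 f) {x : E}
    (hx : IsLocalMin f x) (v : E) : 0 ≤ fderiv ℝ (fderiv ℝ f) x v v := by
  set g : ℝ → ℝ := fun t => f (x + t • v) with hg
  have hf1 : Differentiable ℝ f := hf.differentiable (by norm_num)
  have hf2 : Differentiable ℝ (fderiv ℝ f) :=
    (hf.fderiv_right (m := 1) (by norm_num)).differentiable (by norm_num)
  have hg' : deriv g = fun t => fderiv ℝ f (x + t • v) v :=
    funext fun t => (hasDerivAt_comp_line hf1 x v t).deriv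
  have hg'' : deriv (deriv g) 0 = fderiv ℝ (fderiv ℝ f) x v v := by
    rw [hg']
    have := ((hasDerivAt_comp_line hf2 x v 0).clm_apply (hasDerivAt_const 0 v)).deriv
    simpa using this
  have hline : Continuous fun t : ℝ => x + t • v := by fun_prop
  have hmin : IsLocalMin g 0 := by
    have : Tendsto (fun t : ℝ => x + t • v) (nhds 0) (nhds x) := by
      simpa using hline.tendsto 0
    filter_upwards [this.eventually hx] with t ht
    have ht' : f x ≤ f (x + t • v) := ht
    simpa [hg] using ht'
  by_contra! hneg
  rw [← hg''] at hneg
  have hmax : IsLocalMax g 0 := isLocalMax_of_deriv_deriv_neg hneg hmin.deriv_eq_zero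
    (hf1.continuous.comp hline).continuousAt
  have hconst : g =ᶠ[nhds 0] fun _ => g 0 := by
    filter_upwards [hmin, hmax] with t h1 h2 using le_antisymm h2 h1
  have : deriv (deriv g) 0 = 0 := by
    rw [hconst.deriv.deriv_eq]; simp
  exact hneg.ne this

end

/-- The Hessian matrix of `f : ℝ^d → ℝ` at `x`. -/
noncomputable def hessianMatrix {d : ℕ} (f : (Fin d → ℝ) → ℝ) (x : Fin d → ℝ) :
    Matrix (Fin d) (Fin d) ℝ :=
  Matrix.of fun a b : Fin d => iteratedFDeriv ℝ 2 f x ![Pi.single a 1, Pi.single b 1]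

section
variable {d : ℕ} {f : (Fin d → ℝ) → ℝ} {x : Fin d → ℝ}

theorem hessianMatrix_apply (a b : Fin d) :
    hessianMatrix f x a b = fderiv ℝ (fderiv ℝ f) x (Pi.single a 1) (Pi.single b 1) := by
  simp [hessianMatrix, iteratedFDeriv_two_apply]

theorem posSemidef_hessianMatrix_of_isLocalMin (hf : ContDiff ℝ 2 f) (hx : IsLocalMin f x) :
    (hessianMatrix f x).PosSemidef := by
  refine .of_dotProduct_mulVec_nonneg ?_ fun v => ?_
  · ext a b
    rw [Matrix.conjTranspose_apply, star_trivial, hessianMatrix_apply, hessianMatrix_apply]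
    exact (hf.contDiffAt.isSymmSndFDerivAt (by simp)) _ _
  · have hv : v = ∑ a, v a • (Pi.single a 1 : Fin d → ℝ) := by
      simpa using (pi_eq_sum_univ' v)
    have h := fderiv_fderiv_apply_self_nonneg_of_isLocalMin hf hx v
    have : star v ⬝ᵥ (hessianMatrix f x).mulVec v = fderiv ℝ (fderiv ℝ f) x v v := by
      conv_rhs => rw [hv]
      simp only [map_sum, map_smul, FunLike.coe_sum, Finset.sum_apply, FunLike.coe_smul,
        Pi.smul_apply, smul_eq_mul, dotProduct, Matrix.mulVec, hessianMatrix_apply, Finset.mul_sum,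
        star_trivial]
      rw [Finset.sum_comm]
      refine Finset.sum_congr rfl fun a _ => Finset.sum_congr rfl fun b _ => ?_
      ring
    rwa [this]

theorem hessianDet_empLoss {Z : Type*} {ℓ : (Fin d → ℝ) → Z → ℝ}
    (hsmooth : ∀ z, ContDiff ℝ 2 fun h => ℓ h z) {m : ℕ} (S : Fin m → Z) :
    hessianDet (fun h => empLoss ℓ h S) x =
      ((m : ℝ)⁻¹) ^ d * (∑ j, hessianMatrix (fun h => ℓ h (S j)) x).det := by
  have h : hessianMatrix (fun h => empLoss ℓ h S) x =
      (m : ℝ)⁻¹ • ∑ j, hessianMatrix (fun h => ℓ h (S j)) x := by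
    have hfun : (fun h => empLoss ℓ h S) = (m : ℝ)⁻¹ • (fun h => ∑ j, ℓ h (S j)) := by
      ext h; simp [empLoss, div_eq_inv_mul]
    ext a b
    simp only [hessianMatrix, Matrix.of_apply, Matrix.smul_apply, Matrix.sum_apply, smul_eq_mul]
    rw [hfun, iteratedFDeriv_const_smul_apply
      (ContDiff.sum fun j _ => hsmooth (S j)).contDiffAt,
      iteratedFDeriv_fun_sum_apply fun j _ => (hsmooth (S j)).contDiffAt]
    simp
  calc hessianDet (fun h => empLoss ℓ h S) x = (hessianMatrix (fun h => empLoss ℓ h S) x).det := rfl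
    _ = _ := by rw [h, Matrix.det_smul, Fintype.card_fin]

theorem measurable_fderiv_apply_of_param {Z : Type*} [MeasurableSpace Z] {E : Type*}
    [NormedAddCommGroup E] [NormedSpace ℝ E] {g : E → Z → ℝ} (hg : ∀ h, Measurable (g h))
    {x v : E} (hd : ∀ z, DifferentiableAt ℝ (fun h => g h z) x) :
    Measurable fun z => fderiv ℝ (fun h => g h z) x v := by
  refine measurable_of_tendsto_metrizable (f := fun (k : ℕ) z =>
    ((k : ℝ) + 1) • (g (x + ((k : ℝ) + 1)⁻¹ • v) z - g x z)) (fun k => ?_) ?_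
  · exact ((hg (x + ((k : ℝ) + 1)⁻¹ • v)).sub (hg x)).const_mul ((k : ℝ) + 1)
  · rw [tendsto_pi_nhds]
    intro z
    have h1 : Tendsto (fun k : ℕ => ‖(k : ℝ) + 1‖) atTop atTop :=
      tendsto_norm_atTop_atTop.comp
        (tendsto_atTop_add_const_right _ _ tendsto_natCast_atTop_atTop)
    exact (hd z).hasFDerivAt.lim v h1

theorem measurable_hessianMatrix {Z : Type*} [MeasurableSpace Z] {ℓ : (Fin d → ℝ) → Z → ℝ}
    (hℓ : ∀ h, Measurable (ℓ h)) (hsmooth : ∀ z, ContDiff ℝ 2 fun h => ℓ h z) (a b : Fin d) :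
    Measurable fun z => hessianMatrix (fun h => ℓ h z) x a b := by
  simp only [hessianMatrix_apply]
  have hd1 : ∀ z, Differentiable ℝ fun h => ℓ h z := fun z =>
    (hsmooth z).differentiable (by norm_num)
  have hd2 : ∀ z, Differentiable ℝ (fderiv ℝ fun h => ℓ h z) := fun z =>
    ((hsmooth z).fderiv_right (m := 1) (by norm_num)).differentiable (by norm_num)
  have h := measurable_fderiv_apply_of_param (x := x) (v := Pi.single a 1)
    (g := fun h z => fderiv ℝ (fun h => ℓ h z) h (Pi.single b 1))
    (fun h => measurable_fderiv_apply_of_param hℓ fun z => hd1 z h)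
    (fun z => ((hd2 z) x).clm_apply (differentiableAt_const _))
  convert h using 2 with z
  rw [fderiv_clm_apply (hd2 z x) (differentiableAt_const _)]
  simp

end

section
variable {H : Type*} [MeasurableSpace H] {P : Measure H}

theorem integrable_exp_neg [IsFiniteMeasure P] {G : H → ℝ} (hG : Measurable G)
    (hG0 : ∀ h, 0 ≤ G h) : Integrable (fun h => Real.exp (-G h)) P :=
  Integrable.of_bound (by fun_prop) 1 (ae_of_all _ fun h => by
    simpa [abs_of_pos (Real.exp_pos _)] using hG0 h)

theorem integral_gibbs {G : H → ℝ} (hG : Measurable G) (f : H → ℝ) :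
    ∫ h, f h ∂(gibbs P G) = (∫ h, f h * Real.exp (-G h) ∂P) / ∫ h, Real.exp (-G h) ∂P := by
  rw [gibbs, integral_withDensity_eq_integral_toReal_smul (by fun_prop)
    (ae_of_all _ fun h => ENNReal.ofReal_lt_top), ← integral_div]
  refine integral_congr_ae (ae_of_all _ fun h => ?_)
  have : 0 ≤ Real.exp (-G h) / ∫ h', Real.exp (-G h') ∂P :=
    div_nonneg (Real.exp_pos _).le (integral_nonneg fun _ => (Real.exp_pos _).le)
  simp only [ENNReal.toReal_ofReal this, smul_eq_mul]
  ring

theorem gibbs_gibbs [IsFiniteMeasure P] [NeZero P] {G g : H → ℝ} (hG : Measurable G)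
    (hG0 : ∀ h, 0 ≤ G h) (hg : Measurable g) :
    gibbs (gibbs P G) g = gibbs P fun h => G h + g h := by
  have hZ : 0 < ∫ h, Real.exp (-G h) ∂P := integral_exp_pos (integrable_exp_neg hG hG0)
  have hg' : ∫ h, Real.exp (-g h) ∂(gibbs P G) =
      (∫ h, Real.exp (-(G h + g h)) ∂P) / ∫ h, Real.exp (-G h) ∂P := by
    rw [integral_gibbs hG]
    congr 2 with h
    rw [← Real.exp_add]; congr 1; ring
  conv_lhs => rw [gibbs, hg', gibbs]
  rw [← withDensity_mul _ (by fun_prop) (by fun_prop), gibbs]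
  congr 1 with h
  rw [Pi.mul_apply, ← ENNReal.ofReal_mul (by positivity)]
  congr 1
  rw [div_mul_div_comm, ← Real.exp_add, mul_div_cancel₀ _ hZ.ne', ← neg_add]

theorem iterGibbs_eq_gibbs_sum [IsProbabilityMeasure P] {g : ℕ → H → ℝ}
    (hg : ∀ j, Measurable (g j)) (hg0 : ∀ j h, 0 ≤ g j h) (n : ℕ) :
    iterGibbs P g n = gibbs P fun h => ∑ j ∈ Finset.range n, g j h := by
  induction n with
  | zero => simp [iterGibbs, gibbs]
  | succ n ih =>
    rw [iterGibbs, ih, gibbs_gibbs (by fun_prop) (fun h => Finset.sum_nonneg fun j _ => hg0 j h)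
      (hg n)]
    simp only [Finset.sum_range_succ]

end

theorem mean_mem_Icc {Z : Type*} {K : ℝ} {m : ℕ} (hm : 0 < m) {f : Z → ℝ}
    (hK : ∀ z, f z ∈ Set.Icc 0 K) (S : Fin m → Z) :
    (∑ j, f (S j)) / m ∈ Set.Icc 0 K := by
  have hm' : (0 : ℝ) < m := by exact_mod_cast hm
  refine ⟨div_nonneg (Finset.sum_nonneg fun j _ => (hK _).1) hm'.le, ?_⟩
  rw [div_le_iff₀ hm']
  calc ∑ j, f (S j) ≤ ∑ _j : Fin m, K := Finset.sum_le_sum fun j _ => (hK _).2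
    _ = K * m := by simp [mul_comm]

section
variable {Z : Type*} [MeasurableSpace Z] {D : Measure Z} [IsProbabilityMeasure D] {f : Z → ℝ}
  {K : ℝ}

theorem exp_integral_le_integral_exp (hf : Integrable f D)
    (hexp : Integrable (fun z => Real.exp (f z)) D) :
    Real.exp (∫ z, f z ∂D) ≤ ∫ z, Real.exp (f z) ∂D :=
  convexOn_exp.map_integral_le Real.continuous_exp.continuousOn isClosed_univ
    (ae_of_all _ fun _ => Set.mem_univ _) hf hexp

variable {m : ℕ}

theorem integral_mean (hm : 0 < m) (hf : Measurable f) (hK : ∀ z, f z ∈ Set.Icc 0 K) :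
    ∫ S, (∑ j, f (S j)) / m ∂(Measure.pi fun _ : Fin m => D) = ∫ z, f z ∂D := by
  have hm' : (m : ℝ) ≠ 0 := by exact_mod_cast hm.ne'
  have hint : Integrable f D := Integrable.of_mem_Icc 0 K hf.aemeasurable (ae_of_all _ hK)
  have hmp (j : Fin m) := measurePreserving_eval (fun _ : Fin m => D) j
  rw [integral_div, integral_finsetSum (f := fun (j : Fin m) (S : Fin m → Z) => f (S j)) _ fun j _ =>
    (hmp j).integrable_comp_of_integrable hint]
  have h (j : Fin m) : ∫ S, f (S j) ∂(Measure.pi fun _ : Fin m => D) = ∫ z, f z ∂D := by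
    have := integral_map (hmp j).aemeasurable (f := f) hf.aestronglyMeasurable
    rw [(hmp j).map_eq] at this
    exact this.symm
  simp [h, hm']

theorem exp_neg_mul_integral_le (hm : 0 < m) (hf : Measurable f) (hK : ∀ z, f z ∈ Set.Icc 0 K)
    (t : ℝ) :
    Real.exp (-(t * ∫ z, f z ∂D)) ≤
      ∫ S, Real.exp (-(t * ((∑ j, f (S j)) / m))) ∂(Measure.pi fun _ : Fin m => D) := by
  have h1 : Measurable fun S : Fin m → Z => (∑ j, f (S j)) / m := by fun_prop
  have hint : Integrable (fun S : Fin m → Z => (∑ j, f (S j)) / m)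
      (Measure.pi fun _ : Fin m => D) :=
    Integrable.of_mem_Icc 0 K h1.aemeasurable (ae_of_all _ (mean_mem_Icc hm hK))
  have h := exp_integral_le_integral_exp (D := Measure.pi fun _ : Fin m => D)
    (hint.const_mul (-t)) (ProbabilityTheory.integrable_exp_mul_of_mem_Icc h1.aemeasurable
      (ae_of_all _ (mean_mem_Icc hm hK)))
  rw [integral_const_mul, integral_mean hm hf hK] at h
  simpa only [neg_mul] using h

theorem integral_exp_neg_mul_mean_le (hm : 0 < m) (hf : Measurable f)
    (hK : ∀ z, f z ∈ Set.Icc 0 K) (t : ℝ) :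
    ∫ S, Real.exp (-(t * ((∑ j, f (S j)) / m))) ∂(Measure.pi fun _ : Fin m => D) ≤
      Real.exp (-(t * ∫ z, f z ∂D) + t ^ 2 * K ^ 2 / (8 * m)) := by
  have hm' : (0 : ℝ) < m := by exact_mod_cast hm
  have hsub := (ProbabilityTheory.hasSubgaussianMGF_of_mem_Icc (μ := D) hf.aemeasurable
    (ae_of_all _ hK)).mgf_le (-(t / m))
  have h1 : ∀ S : Fin m → Z, Real.exp (-(t * ((∑ j, f (S j)) / m))) =
      Real.exp (-(t * ∫ z, f z ∂D)) *
        ∏ j, Real.exp (-(t / m) * (f (S j) - ∫ z, f z ∂D)) := by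
    intro S
    rw [← Real.exp_sum, ← Real.exp_add, ← Finset.mul_sum, Finset.sum_sub_distrib]
    congr 1
    simp
    field_simp
    ring
  simp_rw [h1]
  rw [integral_const_mul, integral_fintype_prod_eq_prod (fun (_ : Fin m) z =>
    Real.exp (-(t / m) * (f z - ∫ z, f z ∂D))), Real.exp_add]
  refine mul_le_mul_of_nonneg_left ?_ (Real.exp_pos _).le
  rw [Finset.prod_const, Finset.card_univ, Fintype.card_fin]
  calc (∫ z, Real.exp (-(t / m) * (f z - ∫ z, f z ∂D)) ∂D) ^ m
      ≤ Real.exp (((‖K - 0‖₊ / 2) ^ 2 : NNReal) * (-(t / m)) ^ 2 / 2) ^ m :=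
        pow_le_pow_left₀ (integral_nonneg fun _ => (Real.exp_pos _).le) hsub m
    _ = Real.exp (t ^ 2 * K ^ 2 / (8 * m)) := by
        rw [← Real.exp_nat_mul]
        congr 1
        push_cast
        rw [sub_zero, Real.norm_eq_abs, div_pow, sq_abs]
        field_simp
        ring

end

section
variable {H : Type*} [MeasurableSpace H] {P : Measure H} [IsProbabilityMeasure P]

theorem le_integral_exp_neg {f : H → ℝ} {K : ℝ} (hf : Measurable f)
    (hK : ∀ h, f h ∈ Set.Icc 0 K) {B : Set H} (hB : P B ≠ 0) :
    Real.exp (-(-Real.log (P.real B) + ∫ h, f h ∂(ProbabilityTheory.cond P B))) ≤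
      ∫ h, Real.exp (-f h) ∂P := by
  have := ProbabilityTheory.cond_isProbabilityMeasure hB
  have hB' : 0 < P.real B := ENNReal.toReal_pos hB (measure_ne_top _ _)
  have hint : Integrable f (ProbabilityTheory.cond P B) :=
    Integrable.of_mem_Icc 0 K hf.aemeasurable (ae_of_all _ hK)
  have h1 := exp_integral_le_integral_exp (D := ProbabilityTheory.cond P B) hint.neg
    (integrable_exp_neg hf fun h => (hK h).1)
  calc _ = P.real B * Real.exp (∫ h, (-f) h ∂(ProbabilityTheory.cond P B)) := by
        rw [neg_add, neg_neg, Real.exp_add, Real.exp_log hB']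
        simp only [Pi.neg_apply, integral_neg]
    _ ≤ P.real B * ∫ h, Real.exp ((-f) h) ∂(ProbabilityTheory.cond P B) := by gcongr
    _ = ∫ h in B, Real.exp (-f h) ∂P := by
        rw [ProbabilityTheory.cond, integral_smul_measure, ENNReal.toReal_inv, smul_eq_mul,
          ← mul_assoc, ← Measure.real, mul_inv_cancel₀ hB'.ne', one_mul]
        rfl
    _ ≤ _ := setIntegral_le_integral (integrable_exp_neg hf fun h => (hK h).1)
        (ae_of_all _ fun _ => (Real.exp_pos _).le)

variable {X Y : Type*} [MeasurableSpace X] [MeasurableSpace Y] {μ : Measure X} {ν : Measure Y}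
  [IsProbabilityMeasure μ] [IsProbabilityMeasure ν]

theorem exists_integrable_ge_integral_gibbs {a : H → X → ℝ} {r : H → Y → ℝ} {L : H → ℝ}
    (ha : Measurable (Function.uncurry a)) (hr : Measurable (Function.uncurry r))
    (hL : Measurable L) {K R lam M ε : ℝ} (hlam : 0 < lam)
    (haK : ∀ h x, a h x ∈ Set.Icc 0 K) (hrR : ∀ h y, r h y ∈ Set.Icc 0 R)
    (hLK : ∀ h, L h ∈ Set.Icc 0 K)
    (hcov : ∀ x y, 0 ≤ (∫ h, Real.exp (-(lam * a h x)) * Real.exp (-(lam * r h y)) ∂P) -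
      (∫ h, Real.exp (-(lam * a h x)) ∂P) * ∫ h, Real.exp (-(lam * r h y)) ∂P)
    (hM : ∀ h, ∫ x, Real.exp (lam * (L h - a h x)) ∂μ ≤ M)
    {B : Set H} (hBm : MeasurableSet B) (hB : P B ≠ 0)
    (haL : ∀ h, ∫ x, a h x ∂μ = L h) (hε : ∀ h ∈ B, L h ≤ ε) :
    ∃ U : X × Y → ℝ, Integrable U (μ.prod ν) ∧
      (∀ p, ∫ h, L h ∂(gibbs P fun h => lam * (a h p.1 + r h p.2)) ≤ U p) ∧
      ∫ p, U p ∂(μ.prod ν) ≤ ε + (-Real.log (P.real B) + M - 1) / lam := by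
  have := ProbabilityTheory.cond_isProbabilityMeasure hB
  set P' := ProbabilityTheory.cond P B with hP'
  set b : ℝ := -Real.log (P.real B) with hb
  have hr' : ∀ y, Measurable fun h => r h y := fun y => hr.comp measurable_prodMk_right
  have ha' : ∀ x, Measurable fun h => a h x := fun x => ha.comp measurable_prodMk_right
  set c : X → ℝ := fun x => b + lam * ∫ h, a h x ∂P' with hc
  set W : Y → ℝ := fun y => ∫ h, Real.exp (-(lam * r h y)) ∂P with hW
  set N : X × Y → ℝ := fun p =>
    ∫ h, Real.exp (lam * (L h - a h p.1)) * Real.exp (-(lam * r h p.2)) ∂P with hN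
  have hri : ∀ y, Integrable (fun h => Real.exp (-(lam * r h y))) P := fun y =>
    integrable_exp_neg ((hr' y).const_mul lam) fun h => mul_nonneg hlam.le (hrR h y).1
  have hWpos : ∀ y, 0 < W y := fun y => integral_exp_pos (hri y)
  have hexpK : ∀ h x, Real.exp (lam * (L h - a h x)) ≤ Real.exp (lam * K) := fun h x => by
    have := (hLK h).2; have := (haK h x).1
    exact Real.exp_le_exp.2 (mul_le_mul_of_nonneg_left (by linarith) hlam.le)
  have hLam : Measurable fun q : H × X => Real.exp (lam * (L q.1 - a q.1 q.2)) :=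
    (((hL.comp measurable_fst).sub ha).const_mul lam).exp
  have hrm : Measurable fun q : H × Y => Real.exp (-(lam * r q.1 q.2)) :=
    ((hr.const_mul lam).neg).exp
  have hWm : Measurable W :=
    (hrm.comp measurable_swap).stronglyMeasurable.integral_prod_right'.measurable
  have hcm : Measurable c :=
    ((ha.comp measurable_swap).stronglyMeasurable.integral_prod_right'.measurable.const_mul
      lam).const_add b
  have hF : Measurable fun q : (X × Y) × H =>
      Real.exp (lam * (L q.2 - a q.2 q.1.1)) * Real.exp (-(lam * r q.2 q.1.2)) :=
    (hLam.comp (measurable_snd.prodMk (measurable_fst.comp measurable_fst))).mul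
      (hrm.comp (measurable_snd.prodMk (measurable_snd.comp measurable_fst)))
  have hNm : Measurable N := hF.stronglyMeasurable.integral_prod_right'.measurable
  have hNi : ∀ p : X × Y, Integrable (fun h =>
      Real.exp (lam * (L h - a h p.1)) * Real.exp (-(lam * r h p.2))) P := fun p =>
    (hri p.2).bdd_mul (c := Real.exp (lam * K))
      (hLam.comp measurable_prodMk_right : Measurable fun h =>
        Real.exp (lam * (L h - a h p.1))).aestronglyMeasurable
      (ae_of_all _ fun h => by
        rw [Real.norm_eq_abs, abs_of_pos (Real.exp_pos _)]; exact hexpK h p.1)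
  have hN0 : ∀ p, 0 ≤ N p := fun p => integral_nonneg fun h => by positivity
  have hNW : ∀ p : X × Y, N p ≤ Real.exp (lam * K) * W p.2 := fun p => by
    rw [hW, ← integral_const_mul]
    exact integral_mono (hNi p) ((hri _).const_mul _) fun h =>
      mul_le_mul_of_nonneg_right (hexpK h p.1) (Real.exp_pos _).le
  have hNWi : Integrable (fun p : X × Y => N p / W p.2) (μ.prod ν) :=
    Integrable.of_mem_Icc 0 (Real.exp (lam * K)) (hNm.div (hWm.comp measurable_snd)).aemeasurable
      (ae_of_all _ fun p => ⟨div_nonneg (hN0 p) (hWpos _).le,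
        (div_le_iff₀ (hWpos _)).2 (hNW p)⟩)
  have hci : Integrable c μ := by
    refine Integrable.of_mem_Icc b (b + lam * K) hcm.aemeasurable (ae_of_all _ fun x => ?_)
    have h0 : 0 ≤ ∫ h, a h x ∂P' := integral_nonneg fun h => (haK h x).1
    have h1 : ∫ h, a h x ∂P' ≤ K := by
      calc ∫ h, a h x ∂P' ≤ ∫ _h, K ∂P' := integral_mono
            (Integrable.of_mem_Icc 0 K (ha' x).aemeasurable (ae_of_all _ fun h => haK h x))
            (integrable_const K) fun h => (haK h x).2
        _ = K := by simp
    exact ⟨by simp only [hc]; nlinarith, by simp only [hc]; nlinarith⟩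
  refine ⟨fun p => (c p.1 + N p / W p.2 - 1) / lam, ?_, fun p => ?_, ?_⟩
  · exact (((hci.comp_fst ν).add hNWi).sub (integrable_const 1)).div_const lam
  · obtain ⟨x, y⟩ := p
    simp only
    have hGm : Measurable fun h => lam * (a h x + r h y) :=
      ((ha' x).add (hr' y)).const_mul lam
    have hG0 : ∀ h, 0 ≤ lam * (a h x + r h y) := fun h =>
      mul_nonneg hlam.le (add_nonneg (haK h x).1 (hrR h y).1)
    have hGi := integrable_exp_neg (P := P) hGm hG0
    rw [integral_gibbs hGm]
    set V : ℝ := ∫ h, Real.exp (-(lam * (a h x + r h y))) ∂P with hV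
    have hVpos : 0 < V := integral_exp_pos hGi
    have hVc : Real.exp (-c x) * W y ≤ V := by
      have h1 : Real.exp (-c x) ≤ ∫ h, Real.exp (-(lam * a h x)) ∂P := by
        have := le_integral_exp_neg (P := P) (K := lam * K) ((ha' x).const_mul lam)
          (fun h => ⟨mul_nonneg hlam.le (haK h x).1,
            mul_le_mul_of_nonneg_left (haK h x).2 hlam.le⟩) hB
        rwa [integral_const_mul] at this
      have h2 := hcov x y
      have h3 : ∫ h, Real.exp (-(lam * a h x)) * Real.exp (-(lam * r h y)) ∂P = V := by
        rw [hV]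
        congr 1 with h
        rw [← Real.exp_add]; congr 1; ring
      rw [h3] at h2
      have := mul_le_mul_of_nonneg_right h1 (hWpos y).le
      linarith
    have hLi : Integrable (fun h => L h * Real.exp (-(lam * (a h x + r h y)))) P :=
      hGi.bdd_mul (c := K) hL.aestronglyMeasurable (ae_of_all _ fun h => by
        rw [Real.norm_eq_abs, abs_of_nonneg (hLK h).1]; exact (hLK h).2)
    have hkey : lam * ∫ h, L h * Real.exp (-(lam * (a h x + r h y))) ∂P ≤
        (c x - 1) * V + Real.exp (-c x) * N (x, y) := by
      rw [← integral_const_mul, hV, ← integral_const_mul, hN, ← integral_const_mul,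
        ← integral_add (hGi.const_mul _) ((hNi (x, y)).const_mul _)]
      refine integral_mono (hLi.const_mul _)
        ((hGi.const_mul _).add ((hNi (x, y)).const_mul _)) fun h => ?_
      simp only
      have h1 := Real.add_one_le_exp (lam * L h - c x)
      have h2 : Real.exp (-c x) * (Real.exp (lam * (L h - a h x)) * Real.exp (-(lam * r h y))) =
          Real.exp (lam * L h - c x) * Real.exp (-(lam * (a h x + r h y))) := by
        rw [← Real.exp_add, ← Real.exp_add, ← Real.exp_add]; congr 1; ring
      rw [h2]
      nlinarith [Real.exp_pos (-(lam * (a h x + r h y)))]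
    have hNV : Real.exp (-c x) * N (x, y) / V ≤ N (x, y) / W y := by
      rw [div_le_div_iff₀ hVpos (hWpos y)]
      nlinarith [hN0 (x, y)]
    rw [le_div_iff₀ hlam, div_mul_eq_mul_div, div_le_iff₀ hVpos]
    have h4 : Real.exp (-c x) * N (x, y) ≤ N (x, y) / W y * V := (div_le_iff₀ hVpos).1 hNV
    linarith
  · have hsum : Integrable (fun p : X × Y => c p.1 + N p / W p.2) (μ.prod ν) :=
      (hci.comp_fst ν).add hNWi
    rw [integral_div, integral_sub hsum (integrable_const 1), integral_add (hci.comp_fst ν) hNWi]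
    have h1 : ∫ p : X × Y, c p.1 ∂(μ.prod ν) ≤ b + lam * ε := by
      have hai' : Integrable (Function.uncurry fun x h => a h x) (μ.prod P') :=
        Integrable.of_mem_Icc 0 K (ha.comp measurable_swap).aemeasurable
          (ae_of_all _ fun p => haK p.2 p.1)
      have hai'' : Integrable (fun x => lam * ∫ h, a h x ∂P') μ :=
        hai'.integral_prod_left.const_mul lam
      rw [integral_fun_fst, probReal_univ, one_smul]
      simp only [hc]
      rw [integral_add (integrable_const _) hai'', integral_const_mul,
        integral_integral_swap hai']
      simp_rw [haL]
      have : ∫ h, L h ∂P' ≤ ε := by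
        calc ∫ h, L h ∂P' ≤ ∫ _h, ε ∂P' := integral_mono_ae
              (Integrable.of_mem_Icc 0 K hL.aemeasurable (ae_of_all _ hLK))
              (integrable_const ε) (by
                filter_upwards [ProbabilityTheory.ae_cond_mem hBm] with h hh using hε h hh)
          _ = ε := by simp
      simp only [integral_const, probReal_univ, one_smul]
      nlinarith
    have h2 : ∫ p : X × Y, N p / W p.2 ∂(μ.prod ν) ≤ M := by
      rw [integral_prod_symm _ hNWi]
      have h3 : ∀ y, ∫ x, N (x, y) / W y ∂μ ≤ M := fun y => by
        rw [integral_div, div_le_iff₀ (hWpos y), hN]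
        have hJ : Integrable (Function.uncurry fun x h =>
            Real.exp (lam * (L h - a h x)) * Real.exp (-(lam * r h y))) (μ.prod P) := by
          refine Integrable.of_mem_Icc 0 (Real.exp (lam * K)) (hF.comp ((measurable_fst.prodMk
            measurable_const).prodMk measurable_snd)).aemeasurable (ae_of_all _ fun p => ?_)
          refine ⟨mul_nonneg (Real.exp_pos _).le (Real.exp_pos _).le, ?_⟩
          have h5 : Real.exp (-(lam * r p.2 y)) ≤ 1 :=
            Real.exp_le_one_iff.2 (by nlinarith [mul_nonneg hlam.le (hrR p.2 y).1])
          exact (mul_le_mul (hexpK _ _) h5 (Real.exp_pos _).le (Real.exp_pos _).le).trans_eq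
            (mul_one _)
        rw [integral_integral_swap hJ, hW, ← integral_const_mul]
        refine integral_mono hJ.integral_prod_right ((hri y).const_mul M) fun h => ?_
        simp only [integral_mul_const]
        exact mul_le_mul_of_nonneg_right (hM h) (Real.exp_pos _).le
      calc ∫ y, ∫ x, N (x, y) / W y ∂μ ∂ν ≤ ∫ _y, M ∂ν :=
            integral_mono hNWi.integral_prod_right (integrable_const M) h3
        _ = M := by simp
    have h4 : ∫ _p : X × Y, (1 : ℝ) ∂(μ.prod ν) = 1 := by simp
    rw [h4, ← sub_nonneg]
    have h5 : ε + (b + M - 1) / lam - (∫ p : X × Y, c p.1 ∂(μ.prod ν) +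
        ∫ p : X × Y, N p / W p.2 ∂(μ.prod ν) - 1) / lam =
        (b + lam * ε + M - (∫ p : X × Y, c p.1 ∂(μ.prod ν) +
        ∫ p : X × Y, N p / W p.2 ∂(μ.prod ν))) / lam := by field_simp; ring
    rw [h5]
    exact div_nonneg (by linarith) hlam.le

end

theorem sum_erase_eq_sum_succAbove {T : ℕ} (i : Fin (T + 1)) (f : Fin (T + 1) → ℝ) :
    ∑ k ∈ Finset.univ.erase i, f k = ∑ j, f (i.succAbove j) := by
  have h1 := Finset.add_sum_erase Finset.univ f (Finset.mem_univ i)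
  rw [Fin.sum_univ_succAbove f i] at h1
  linarith

theorem empLoss_mem_Icc {H Z : Type*} {ℓ : H → Z → ℝ} {K : ℝ}
    (hb : ∀ h z, ℓ h z ∈ Set.Icc 0 K) {m : ℕ} (hm : 0 < m) (h : H)
    (S : Fin m → Z) : empLoss ℓ h S ∈ Set.Icc 0 K :=
  mean_mem_Icc hm (hb h) S

section
variable {H Z : Type*} [MeasurableSpace H] [MeasurableSpace Z] {ℓ : H → Z → ℝ} {K : ℝ}

theorem measurable_uncurry_empLoss (hℓ : Measurable (Function.uncurry ℓ)) (m : ℕ) :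
    Measurable (Function.uncurry fun (h : H) (S : Fin m → Z) => empLoss ℓ h S) :=
  (Finset.measurable_sum _ fun j _ => hℓ.comp (measurable_fst.prodMk
    ((measurable_pi_apply j).comp measurable_snd))).div_const _

theorem expLoss_mem_Icc (hb : ∀ h z, ℓ h z ∈ Set.Icc 0 K) (hℓ : Measurable (Function.uncurry ℓ))
    (D : Measure Z) [IsProbabilityMeasure D] (h : H) : expLoss ℓ h D ∈ Set.Icc 0 K := by
  refine ⟨integral_nonneg fun z => (hb h z).1, ?_⟩
  calc ∫ z, ℓ h z ∂D ≤ ∫ _z, K ∂D := integral_mono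
        (Integrable.of_mem_Icc 0 K (hℓ.comp measurable_prodMk_left).aemeasurable
          (ae_of_all _ fun z => hb h z)) (integrable_const K) fun z => (hb h z).2
    _ = K := by simp

theorem exists_integrable_ge_expLoss_gibbs {P : Measure H} [IsProbabilityMeasure P]
    (hℓ : Measurable (Function.uncurry ℓ)) (hb : ∀ h z, ℓ h z ∈ Set.Icc 0 K) {T m : ℕ}
    (hm : 0 < m) (D : Fin (T + 1) → Measure Z) [∀ k, IsProbabilityMeasure (D k)]
    (i : Fin (T + 1))
    (hcov : ∀ ω : Fin (T + 1) → Fin m → Z,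
      0 ≤ (∫ h, Real.exp (-(Real.sqrt m * empLoss ℓ h (ω i))) *
            Real.exp (-(Real.sqrt m * ∑ k ∈ Finset.univ.erase i, empLoss ℓ h (ω k))) ∂P) -
        (∫ h, Real.exp (-(Real.sqrt m * empLoss ℓ h (ω i))) ∂P) *
          ∫ h, Real.exp (-(Real.sqrt m * ∑ k ∈ Finset.univ.erase i, empLoss ℓ h (ω k))) ∂P)
    {B : Set H} (hBm : MeasurableSet B) (hB : P B ≠ 0) {ε : ℝ}
    (hε : ∀ h ∈ B, expLoss ℓ h (D i) ≤ ε) :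
    ∃ U : (Fin (T + 1) → Fin m → Z) → ℝ,
      Integrable U (Measure.pi fun k => Measure.pi fun _ : Fin m => D k) ∧
      (∀ ω, ∫ h, expLoss ℓ h (D i) ∂(gibbs P fun h => √m * ∑ k, empLoss ℓ h (ω k)) ≤ U ω) ∧
      ∫ ω, U ω ∂(Measure.pi fun k => Measure.pi fun _ : Fin m => D k) ≤
        ε + (-Real.log (P.real B) + Real.exp (K ^ 2 / 8) - 1) / √m := by
  have hm' : (0 : ℝ) < m := by exact_mod_cast hm
  have hs : 0 < √(m : ℝ) := Real.sqrt_pos.2 hm'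
  let e := MeasurableEquiv.piFinSuccAbove (fun _ : Fin (T + 1) => Fin m → Z) i
  have he : MeasurePreserving e _ _ := measurePreserving_piFinSuccAbove
    (fun k : Fin (T + 1) => Measure.pi fun _ : Fin m => D k) i
  have hfst : ∀ ω, (e ω).1 = ω i := fun ω => rfl
  have hsnd : ∀ ω j, (e ω).2 j = ω (i.succAbove j) := fun ω j => rfl
  have hmeas : ∀ h, Measurable (ℓ h) := fun h => hℓ.comp measurable_prodMk_left
  have hL : Measurable fun h => expLoss ℓ h (D i) :=
    hℓ.stronglyMeasurable.integral_prod_right'.measurable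
  obtain ⟨U, hU, hle, hint⟩ := exists_integrable_ge_integral_gibbs (P := P)
    (μ := Measure.pi fun _ : Fin m => D i)
    (ν := Measure.pi fun j : Fin T => Measure.pi fun _ : Fin m => D (i.succAbove j))
    (a := fun h S => empLoss ℓ h S) (r := fun h y => ∑ j, empLoss ℓ h (y j))
    (L := fun h => expLoss ℓ h (D i)) (K := K) (R := T * K) (M := Real.exp (K ^ 2 / 8)) (ε := ε)
    (measurable_uncurry_empLoss hℓ m)
    (Finset.measurable_sum _ fun j _ => (measurable_uncurry_empLoss hℓ m).comp
      (measurable_fst.prodMk ((measurable_pi_apply j).comp measurable_snd)))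
    hL hs (empLoss_mem_Icc hb hm)
    (fun h y => ⟨Finset.sum_nonneg fun j _ => (empLoss_mem_Icc hb hm h _).1, by
      calc ∑ j, empLoss ℓ h (y j) ≤ ∑ _j : Fin T, K :=
            Finset.sum_le_sum fun j _ => (empLoss_mem_Icc hb hm h _).2
        _ = T * K := by simp⟩)
    (expLoss_mem_Icc hb hℓ (D i))
    (fun x y => by
      have h := hcov (e.symm (x, y))
      simp only [sum_erase_eq_sum_succAbove, ← hfst, ← hsnd, e.apply_symm_apply] at h
      exact h)
    (fun h => by
      have h1 := integral_exp_neg_mul_mean_le (D := D i) hm (hmeas h) (hb h) √m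
      have h2 : ∀ S : Fin m → Z, Real.exp (√m * (expLoss ℓ h (D i) - empLoss ℓ h S)) =
          Real.exp (√m * expLoss ℓ h (D i)) * Real.exp (-(√m * ((∑ j, ℓ h (S j)) / m))) := by
        intro S
        rw [← Real.exp_add, empLoss]; congr 1; ring
      simp_rw [h2]
      rw [integral_const_mul]
      refine (mul_le_mul_of_nonneg_left h1 (Real.exp_pos _).le).trans_eq ?_
      rw [← Real.exp_add, Real.sq_sqrt hm'.le, expLoss]
      congr 1
      field_simp
      ring)
    hBm hB (fun h => integral_mean hm (hmeas h) (hb h)) hε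
  refine ⟨U ∘ e, he.integrable_comp_of_integrable hU, fun ω => ?_, ?_⟩
  · refine le_trans (le_of_eq ?_) (hle (e ω))
    congr 2
    ext h
    rw [Fin.sum_univ_succAbove _ i]
    rfl
  · exact (he.integral_comp' U).trans_le hint

end

theorem iterGibbs_dite_eq_gibbs {H Z : Type*} [MeasurableSpace H] [MeasurableSpace Z]
    {P : Measure H} [IsProbabilityMeasure P] {ℓ : H → Z → ℝ} {K : ℝ}
    (hℓ : Measurable (Function.uncurry ℓ)) (hb : ∀ h z, ℓ h z ∈ Set.Icc 0 K) {T m : ℕ}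
    (hm : 0 < m) (ω : Fin T → Fin m → Z) :
    iterGibbs P (fun j h => if hj : j < T then √m * empLoss ℓ h (ω ⟨j, hj⟩) else 0) T =
      gibbs P fun h => √m * ∑ k, empLoss ℓ h (ω k) := by
  rw [iterGibbs_eq_gibbs_sum]
  · congr 1
    ext h
    rw [Finset.sum_range, Finset.mul_sum]
    simp
  · intro j
    by_cases hj : j < T
    · simp only [hj, dite_true]
      exact ((measurable_uncurry_empLoss hℓ m).comp measurable_prodMk_right).const_mul _
    · simp [hj]
  · intro j h
    by_cases hj : j < T
    · simpa only [hj, dite_true] using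
        mul_nonneg (Real.sqrt_nonneg _) (empLoss_mem_Icc hb hm h _).1
    · simp [hj]

theorem limit_expected_risk_le {H Z : Type*} [MeasurableSpace H] [MeasurableSpace Z]
    {P : Measure H} [IsProbabilityMeasure P] {ℓ : H → Z → ℝ} {K : ℝ}
    (hℓ : Measurable (Function.uncurry ℓ)) (hb : ∀ h z, ℓ h z ∈ Set.Icc 0 K) {T : ℕ}
    (hT : 2 ≤ T) (D : ℕ → Measure Z) (hD : ∀ j < T, IsProbabilityMeasure (D j)) (hstar : ℕ → H)
    (hpos : ∀ i < T - 1, ∀ ε > 0,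
      P {h | expLoss ℓ h (D i) < expLoss ℓ (hstar i) (D i) + ε} ≠ 0)
    (hcov : ∀ (m : ℕ), 0 < m → ∀ (ω : Fin T → Fin m → Z), ∀ i, ∀ hi : i < T - 1,
      0 ≤ (∫ h, Real.exp (-(Real.sqrt m * empLoss ℓ h (ω ⟨i, Nat.lt_of_lt_pred hi⟩))) *
            Real.exp (-(Real.sqrt m *
              ∑ k ∈ Finset.univ.erase (⟨i, Nat.lt_of_lt_pred hi⟩ : Fin T), empLoss ℓ h (ω k))) ∂P) -
        (∫ h, Real.exp (-(Real.sqrt m * empLoss ℓ h (ω ⟨i, Nat.lt_of_lt_pred hi⟩))) ∂P) *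
          ∫ h, Real.exp (-(Real.sqrt m *
            ∑ k ∈ Finset.univ.erase (⟨i, Nat.lt_of_lt_pred hi⟩ : Fin T), empLoss ℓ h (ω k))) ∂P)
    {A : ℝ}
    (hA : Tendsto (fun m : ℕ =>
      (1 / ((T : ℝ) - 1)) *
        ∫ ω, (∑ i ∈ Finset.range (T - 1),
            ∫ h, expLoss ℓ h (D i)
              ∂(iterGibbs P (fun j h => if hj : j < T then
                  Real.sqrt m * empLoss ℓ h (ω ⟨j, hj⟩) else 0) T))
          ∂(Measure.pi fun k : Fin T => Measure.pi fun _ : Fin m => D (k : ℕ)))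
      atTop (nhds A)) :
    A ≤ (1 / ((T : ℝ) - 1)) * ∑ i ∈ Finset.range (T - 1), expLoss ℓ (hstar i) (D i) := by
  obtain ⟨T, rfl⟩ : ∃ n, T = n + 1 := ⟨T - 1, by omega⟩
  have : ∀ k : Fin (T + 1), IsProbabilityMeasure (D k) := fun k => hD k k.2
  have hT' : (0 : ℝ) < T := by exact_mod_cast (by omega : 0 < T)
  refine le_of_forall_pos_le_add fun ε hε => ?_
  set B : ℕ → Set H := fun i => {h | expLoss ℓ h (D i) < expLoss ℓ (hstar i) (D i) + ε} with hB
  set c : ℕ → ℝ := fun i => -Real.log (P.real (B i)) + Real.exp (K ^ 2 / 8) - 1 with hc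
  have hlim : Tendsto (fun m : ℕ => (1 / ((T + 1 : ℕ) - 1 : ℝ)) * ∑ i ∈ Finset.range (T + 1 - 1),
      (expLoss ℓ (hstar i) (D i) + ε + c i / √m)) atTop
      (nhds ((1 / ((T + 1 : ℕ) - 1 : ℝ)) * ∑ i ∈ Finset.range (T + 1 - 1),
        (expLoss ℓ (hstar i) (D i) + ε + 0))) := by
    refine (tendsto_finsetSum _ fun i _ => ?_).const_mul _
    exact ((Real.tendsto_sqrt_atTop.comp tendsto_natCast_atTop_atTop).const_div_atTop (c i)
      ).const_add _
  have hlim_eq : (1 / ((T + 1 : ℕ) - 1 : ℝ)) * ∑ i ∈ Finset.range (T + 1 - 1),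
      (expLoss ℓ (hstar i) (D i) + ε + 0) = (1 / ((T + 1 : ℕ) - 1 : ℝ)) *
        ∑ i ∈ Finset.range (T + 1 - 1), expLoss ℓ (hstar i) (D i) + ε := by
    simp only [add_zero, Finset.sum_add_distrib, mul_add, Finset.sum_const, Finset.card_range,
      Nat.add_sub_cancel, nsmul_eq_mul, Nat.cast_add, Nat.cast_one, add_sub_cancel_right]
    field_simp
  rw [hlim_eq] at hlim
  refine le_of_tendsto_of_tendsto hA hlim ?_
  filter_upwards [eventually_gt_atTop 0] with m hm
  have hT1 : (0 : ℝ) ≤ 1 / ((T + 1 : ℕ) - 1 : ℝ) := by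
    rw [Nat.cast_add, Nat.cast_one, add_sub_cancel_right]; positivity
  refine mul_le_mul_of_nonneg_left ?_ hT1
  have hU : ∀ i ∈ Finset.range (T + 1 - 1), ∃ U : (Fin (T + 1) → Fin m → Z) → ℝ,
      Integrable U (Measure.pi fun k : Fin (T + 1) => Measure.pi fun _ : Fin m => D k) ∧
      (∀ ω, ∫ h, expLoss ℓ h (D i) ∂(gibbs P fun h => √m * ∑ k, empLoss ℓ h (ω k)) ≤ U ω) ∧
      ∫ ω, U ω ∂(Measure.pi fun k : Fin (T + 1) => Measure.pi fun _ : Fin m => D k) ≤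
        expLoss ℓ (hstar i) (D i) + ε + c i / √m := by
    intro i hi
    rw [Finset.mem_range] at hi
    have := hD i (by omega)
    exact exists_integrable_ge_expLoss_gibbs hℓ hb hm (fun k => D k) ⟨i, by omega⟩
      (fun ω => hcov m hm ω i hi)
      (measurableSet_lt hℓ.stronglyMeasurable.integral_prod_right'.measurable measurable_const)
      (hpos i hi ε hε) fun h hh => le_of_lt hh
  choose! U hUi hUle hUint using hU
  simp only [iterGibbs_dite_eq_gibbs hℓ hb hm]
  calc _ ≤ ∫ ω, ∑ i ∈ Finset.range (T + 1 - 1), U i ω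
        ∂(Measure.pi fun k : Fin (T + 1) => Measure.pi fun _ : Fin m => D k) := by
        refine integral_mono_of_nonneg (ae_of_all _ fun ω => Finset.sum_nonneg fun i hi => ?_)
          (integrable_finsetSum _ hUi) (ae_of_all _ fun ω => Finset.sum_le_sum fun i hi =>
            hUle i hi ω)
        exact integral_nonneg fun h => integral_nonneg fun z => (hb h z).1
    _ = ∑ i ∈ Finset.range (T + 1 - 1), ∫ ω, U i ω
        ∂(Measure.pi fun k : Fin (T + 1) => Measure.pi fun _ : Fin m => D k) :=
        integral_finsetSum _ hUi
    _ ≤ _ := Finset.sum_le_sum hUint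

section
variable {H : Type*} [MeasurableSpace H] {P : Measure H} [IsProbabilityMeasure P]

theorem measureReal_mul_exp_le_integral {u : H → ℝ} (hu : Measurable u) (hu0 : ∀ h, 0 ≤ u h)
    {t : ℝ} (ht : 0 ≤ t) (a : ℝ) :
    P.real {h | u h < a} * Real.exp (-(t * a)) ≤ ∫ h, Real.exp (-(t * u h)) ∂P := by
  have h1 := mul_meas_ge_le_integral_of_nonneg
    (ae_of_all P fun h => (Real.exp_pos (-(t * u h))).le)
    (integrable_exp_neg (hu.const_mul t) fun h => mul_nonneg ht (hu0 h)) (Real.exp (-(t * a)))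
  refine le_trans ?_ h1
  rw [mul_comm]
  refine mul_le_mul_of_nonneg_left (measureReal_mono fun h hh => ?_) (Real.exp_pos _).le
  exact Real.exp_le_exp.2 (neg_le_neg (mul_le_mul_of_nonneg_left (le_of_lt hh) ht))

variable [TopologicalSpace H]

theorem measureReal_lt_pos_of_mem_support {u : H → ℝ} (hu : Continuous u) {h : H}
    (hh : h ∈ P.support) {a : ℝ} (ha : u h < a) : 0 < P.real {h | u h < a} :=
  ENNReal.toReal_pos ((Measure.mem_support_iff_forall _).1 hh _
    (hu.continuousAt.eventually_lt_const ha)).ne' (measure_ne_top _ _)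

variable [HereditarilyLindelofSpace H] [OpensMeasurableSpace H]

/-- Laplace asymptotics: if `∫ e^{-tu} ∫ e^{-tv} ≤ C ∫ e^{-t(u+v)}` along `t → ∞` and `v` has a
unique minimizer on the support of `P`, then that point also minimizes `u`. -/
theorem le_of_integral_exp_mul_integral_exp_le {u v : H → ℝ} (hu : Continuous u)
    (hv : Continuous v) (hu0 : ∀ h, 0 ≤ u h) (hv0 : ∀ h, 0 ≤ v h) (hsupp : IsCompact P.support)
    {x : H} (hx : x ∈ P.support) (hxv : ∀ h ∈ P.support, h ≠ x → v x < v h) {C : ℝ}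
    {t : ℕ → ℝ} (ht : Tendsto t atTop atTop)
    (hle : ∀ᶠ m in atTop, (∫ h, Real.exp (-(t m * u h)) ∂P) * ∫ h, Real.exp (-(t m * v h)) ∂P ≤
      C * ∫ h, Real.exp (-(t m * (u h + v h))) ∂P) :
    ∀ h ∈ P.support, u x ≤ u h := by
  obtain ⟨a, ha, hamin⟩ := hsupp.exists_isMinOn ⟨x, hx⟩ hu.continuousOn
  obtain ⟨b, hb, hbmin⟩ := hsupp.exists_isMinOn ⟨x, hx⟩ (hu.add hv).continuousOn
  have hamin' : ∀ h ∈ P.support, u a ≤ u h := fun h hh => hamin hh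
  have hbmin' : ∀ h ∈ P.support, u b + v b ≤ u h + v h := fun h hh => hbmin hh
  suffices hxa : u x ≤ u a from fun h hh => hxa.trans (hamin' h hh)
  by_contra! hlt
  have hgap : u a + v x < u b + v b := by
    by_cases hbx : b = x
    · rw [hbx]; linarith
    · linarith [hamin' b hb, hxv b hb hbx]
  set δ := (u b + v b - (u a + v x)) / 3 with hδ
  have hδ0 : 0 < δ := by rw [hδ]; linarith
  set p := P.real {h | u h < u a + δ} with hp
  set q := P.real {h | v h < v x + δ} with hq
  have hp0 : 0 < p := measureReal_lt_pos_of_mem_support hu ha (by linarith)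
  have hq0 : 0 < q := measureReal_lt_pos_of_mem_support hv hx (by linarith)
  have hlim : Tendsto (fun m => p * q * Real.exp (t m * δ)) atTop atTop :=
    (Real.tendsto_exp_atTop.comp (ht.atTop_mul_const hδ0)).const_mul_atTop (mul_pos hp0 hq0)
  obtain ⟨m, hm, hm0, hmC⟩ := (hle.and ((ht.eventually_ge_atTop 0).and
    (hlim.eventually_gt_atTop |C|))).exists
  have h1 := measureReal_mul_exp_le_integral (P := P) hu.measurable hu0 hm0 (u a + δ)
  have h2 := measureReal_mul_exp_le_integral (P := P) hv.measurable hv0 hm0 (v x + δ)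
  have h3 : ∫ h, Real.exp (-(t m * (u h + v h))) ∂P ≤ Real.exp (-(t m * (u b + v b))) := by
    calc ∫ h, Real.exp (-(t m * (u h + v h))) ∂P
        ≤ ∫ _h, Real.exp (-(t m * (u b + v b))) ∂P := by
          refine integral_mono_ae (integrable_exp_neg
            (((hu.measurable.add hv.measurable)).const_mul _)
            fun h => mul_nonneg hm0 (add_nonneg (hu0 h) (hv0 h))) (integrable_const _) ?_
          filter_upwards [P.support_mem_ae] with h hh
          exact Real.exp_le_exp.2 (neg_le_neg (mul_le_mul_of_nonneg_left (hbmin' h hh) hm0))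
      _ = _ := by simp
  have h4 : p * q * Real.exp (t m * δ) * Real.exp (-(t m * (u b + v b))) ≤
      |C| * Real.exp (-(t m * (u b + v b))) := by
    calc p * q * Real.exp (t m * δ) * Real.exp (-(t m * (u b + v b)))
        = (p * Real.exp (-(t m * (u a + δ)))) * (q * Real.exp (-(t m * (v x + δ)))) := by
          rw [mul_mul_mul_comm, mul_assoc (p * q), ← Real.exp_add, ← Real.exp_add, hδ]
          congr 2; ring
      _ ≤ _ := mul_le_mul h1 h2 (by positivity) (integral_nonneg fun _ => (Real.exp_pos _).le)
      _ ≤ _ := hm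
      _ ≤ |C| * ∫ h, Real.exp (-(t m * (u h + v h))) ∂P := mul_le_mul_of_nonneg_right
          (le_abs_self C) (integral_nonneg fun _ => (Real.exp_pos _).le)
      _ ≤ _ := mul_le_mul_of_nonneg_left h3 (abs_nonneg C)
  exact absurd (le_of_mul_le_mul_right h4 (Real.exp_pos _)) (not_le.2 hmC)

end

section
variable {H Z : Type*} [MeasurableSpace H] [MeasurableSpace Z] {ℓ : H → Z → ℝ} {K : ℝ}

theorem integral_exp_mul_integral_exp_expLoss_le {P : Measure H} [IsProbabilityMeasure P]
    (hℓ : Measurable (Function.uncurry ℓ)) (hb : ∀ h z, ℓ h z ∈ Set.Icc 0 K) {m : ℕ}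
    (hm : 0 < m) (D : Measure Z) [IsProbabilityMeasure D] {u : H → ℝ} (hu : Measurable u)
    (hu0 : ∀ h, 0 ≤ u h) {τ : ℝ} (hτ : 0 ≤ τ)
    (hcov : ∀ S : Fin m → Z, (∫ h, Real.exp (-(√m * u h)) ∂P) *
        ∫ h, Real.exp (-(√m * (τ * empLoss ℓ h S))) ∂P ≤
      ∫ h, Real.exp (-(√m * u h)) * Real.exp (-(√m * (τ * empLoss ℓ h S))) ∂P) :
    (∫ h, Real.exp (-(√m * u h)) ∂P) * ∫ h, Real.exp (-(√m * (τ * expLoss ℓ h D))) ∂P ≤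
      Real.exp (τ ^ 2 * K ^ 2 / 8) * ∫ h, Real.exp (-(√m * (u h + τ * expLoss ℓ h D))) ∂P := by
  have hm' : (0 : ℝ) < m := by exact_mod_cast hm
  set μ := Measure.pi fun _ : Fin m => D with hμ
  have hmeas : ∀ h, Measurable (ℓ h) := fun h => hℓ.comp measurable_prodMk_left
  have hL : Measurable fun h => expLoss ℓ h D :=
    hℓ.stronglyMeasurable.integral_prod_right'.measurable
  have hL0 : ∀ h, 0 ≤ expLoss ℓ h D := fun h => (expLoss_mem_Icc hb hℓ D h).1
  have hE := measurable_uncurry_empLoss hℓ m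
  have hG : Measurable fun q : H × (Fin m → Z) =>
      Real.exp (-(√m * (τ * empLoss ℓ q.1 q.2))) := ((hE.const_mul τ).const_mul √m).neg.exp
  have hwm : Measurable fun h => Real.exp (-(√m * u h)) := (hu.const_mul _).neg.exp
  have hle1 : ∀ x : ℝ, 0 ≤ x → Real.exp (-(√m * x)) ∈ Set.Icc 0 1 := fun x hx =>
    ⟨(Real.exp_pos _).le, Real.exp_le_one_iff.2 (by have := Real.sqrt_nonneg m; nlinarith)⟩
  have hE0 : ∀ h (S : Fin m → Z), 0 ≤ τ * empLoss ℓ h S := fun h S =>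
    mul_nonneg hτ (empLoss_mem_Icc hb hm h S).1
  have hI1 : Integrable (Function.uncurry fun h (S : Fin m → Z) =>
      Real.exp (-(√m * (τ * empLoss ℓ h S)))) (P.prod μ) :=
    Integrable.of_mem_Icc 0 1 hG.aemeasurable (ae_of_all _ fun q => hle1 _ (hE0 q.1 q.2))
  have hI2 : Integrable (Function.uncurry fun h (S : Fin m → Z) =>
      Real.exp (-(√m * u h)) * Real.exp (-(√m * (τ * empLoss ℓ h S)))) (P.prod μ) :=
    Integrable.of_mem_Icc 0 1 ((hwm.comp measurable_fst).mul hG).aemeasurable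
      (ae_of_all _ fun q => ⟨mul_nonneg (hle1 _ (hu0 _)).1 (hle1 _ (hE0 q.1 q.2)).1,
        mul_le_one₀ (hle1 _ (hu0 _)).2 (hle1 _ (hE0 q.1 q.2)).1 (hle1 _ (hE0 q.1 q.2)).2⟩)
  have hlow : ∀ h, Real.exp (-(√m * (τ * expLoss ℓ h D))) ≤
      ∫ S, Real.exp (-(√m * (τ * empLoss ℓ h S))) ∂μ := fun h => by
    have := exp_neg_mul_integral_le (D := D) hm (hmeas h) (hb h) (√m * τ)
    simp only [mul_assoc] at this
    exact this
  have hupp : ∀ h, ∫ S, Real.exp (-(√m * (τ * empLoss ℓ h S))) ∂μ ≤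
      Real.exp (τ ^ 2 * K ^ 2 / 8) * Real.exp (-(√m * (τ * expLoss ℓ h D))) := fun h => by
    have := integral_exp_neg_mul_mean_le (D := D) hm (hmeas h) (hb h) (√m * τ)
    simp only [mul_assoc] at this
    refine this.trans_eq ?_
    rw [← Real.exp_add, ← mul_assoc √(m : ℝ) τ, mul_pow, Real.sq_sqrt hm'.le, expLoss]
    congr 1
    field_simp
    ring
  calc (∫ h, Real.exp (-(√m * u h)) ∂P) * ∫ h, Real.exp (-(√m * (τ * expLoss ℓ h D))) ∂P
      ≤ (∫ h, Real.exp (-(√m * u h)) ∂P) *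
          ∫ h, ∫ S, Real.exp (-(√m * (τ * empLoss ℓ h S))) ∂μ ∂P := by
        refine mul_le_mul_of_nonneg_left ?_ (integral_nonneg fun _ => (Real.exp_pos _).le)
        exact integral_mono (integrable_exp_neg ((hL.const_mul τ).const_mul _) fun h =>
          mul_nonneg (Real.sqrt_nonneg _) (mul_nonneg hτ (hL0 h))) hI1.integral_prod_left hlow
    _ = ∫ S, (∫ h, Real.exp (-(√m * u h)) ∂P) *
          ∫ h, Real.exp (-(√m * (τ * empLoss ℓ h S))) ∂P ∂μ := by
        rw [integral_const_mul, integral_integral_swap hI1]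
    _ ≤ ∫ S, ∫ h, Real.exp (-(√m * u h)) * Real.exp (-(√m * (τ * empLoss ℓ h S))) ∂P ∂μ :=
        integral_mono (hI1.integral_prod_right.const_mul _) hI2.integral_prod_right hcov
    _ = ∫ h, ∫ S, Real.exp (-(√m * u h)) * Real.exp (-(√m * (τ * empLoss ℓ h S))) ∂μ ∂P :=
        (integral_integral_swap hI2).symm
    _ ≤ ∫ h, Real.exp (τ ^ 2 * K ^ 2 / 8) *
          Real.exp (-(√m * (u h + τ * expLoss ℓ h D))) ∂P := by
        refine integral_mono hI2.integral_prod_left ((integrable_exp_neg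
          ((hu.add (hL.const_mul τ)).const_mul _) fun h => mul_nonneg (Real.sqrt_nonneg _)
            (add_nonneg (hu0 h) (mul_nonneg hτ (hL0 h)))).const_mul _) fun h => ?_
        simp only [integral_const_mul]
        refine (mul_le_mul_of_nonneg_left (hupp h) (Real.exp_pos _).le).trans_eq ?_
        rw [mul_left_comm, ← Real.exp_add]
        congr 2; ring
    _ = _ := integral_const_mul _ _

end

theorem integrable_of_integrable_sum_pi {T : ℕ} {α : Fin T → Type*} [∀ k, MeasurableSpace (α k)]
    {μ : ∀ k, Measure (α k)} [∀ k, IsProbabilityMeasure (μ k)] {F : ∀ k, α k → ℝ}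
    {s : Finset (Fin T)} (h : Integrable (fun ω => ∑ k ∈ s, F k (ω k)) (Measure.pi μ))
    {k : Fin T} (hk : k ∈ s) : Integrable (F k) (μ k) := by
  obtain ⟨T, rfl⟩ : ∃ n, T = n + 1 := ⟨T - 1, by have := k.2; omega⟩
  have he := measurePreserving_piFinSuccAbove μ k
  have h1 : Integrable (fun p => ∑ j ∈ s, F j (k.insertNth p.1 p.2 j))
      ((μ k).prod (Measure.pi fun j => μ (k.succAbove j))) :=
    (he.symm _).integrable_comp_of_integrable h
  obtain ⟨y, hy⟩ := h1.prod_left_ae.exists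
  obtain ⟨x₀⟩ : Nonempty (α k) := (μ k).nonempty_of_neZero
  refine (hy.sub (integrable_const
    (∑ j ∈ s.erase k, F j (k.insertNth (α := α) x₀ y j)))).congr (ae_of_all _ fun x => ?_)
  have h2 : ∑ j ∈ s.erase k, F j (k.insertNth (α := α) x y j) =
      ∑ j ∈ s.erase k, F j (k.insertNth (α := α) x₀ y j) := by
    refine Finset.sum_congr rfl fun j hj => ?_
    obtain ⟨i, rfl⟩ := Fin.exists_succAbove_eq (Finset.ne_of_mem_erase hj)
    simp only [Fin.insertNth_apply_succAbove]
  simp only [Pi.sub_apply]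
  rw [← Finset.add_sum_erase s _ hk, h2, Fin.insertNth_apply_same, add_sub_cancel_right]

section
variable {d : ℕ} {Z : Type*} {ℓ : (Fin d → ℝ) → Z → ℝ} {x : Fin d → ℝ}

theorem neg_le_log_hessianDet (hsmooth : ∀ z, ContDiff ℝ 2 fun h => ℓ h z)
    {m : ℕ} (hm : 0 < m) (S : Fin m → Z) :
    -(negLogDet (∑ j, hessianMatrix (fun h => ℓ h (S j)) x) + d * Real.log m) ≤
      Real.log (hessianDet (fun h => empLoss ℓ h S) x) := by
  have hm' : (m : ℝ) ≠ 0 := by exact_mod_cast hm.ne'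
  rw [hessianDet_empLoss hsmooth]
  by_cases hdet : (∑ j, hessianMatrix (fun h => ℓ h (S j)) x).det = 0
  · rw [negLogDet_of_det_eq_zero hdet, hdet, mul_zero, Real.log_zero, zero_add]
    exact neg_nonpos.2 (by positivity)
  · rw [Real.log_mul (pow_ne_zero _ (inv_ne_zero hm')) hdet, Real.log_pow, Real.log_inv]
    have : -Real.log (∑ j, hessianMatrix (fun h => ℓ h (S j)) x).det ≤
      negLogDet (∑ j, hessianMatrix (fun h => ℓ h (S j)) x) := le_max_right _ _
    linarith

theorem negLogDet_le_abs_log_hessianDet (hsmooth : ∀ z, ContDiff ℝ 2 fun h => ℓ h z) {m : ℕ}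
    (hm : 0 < m) (S : Fin m → Z) :
    negLogDet (∑ j, hessianMatrix (fun h => ℓ h (S j)) x) ≤
      |Real.log (hessianDet (fun h => empLoss ℓ h S) x)| := by
  have hm' : (m : ℝ) ≠ 0 := by exact_mod_cast hm.ne'
  rw [hessianDet_empLoss hsmooth]
  by_cases hdet : (∑ j, hessianMatrix (fun h => ℓ h (S j)) x).det = 0
  · rw [negLogDet_of_det_eq_zero hdet]; exact abs_nonneg _
  · rw [Real.log_mul (pow_ne_zero _ (inv_ne_zero hm')) hdet, Real.log_pow, Real.log_inv]
    have : 0 ≤ d * Real.log m := by positivity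
    refine max_le (abs_nonneg _) (le_trans ?_ (neg_le_abs _))
    linarith

variable [MeasurableSpace Z]

theorem expNegLogDet_ne_top_of_integrable {D : Measure Z}
    (hsmooth : ∀ z, ContDiff ℝ 2 fun h => ℓ h z) {m : ℕ} (hm : 0 < m)
    (hint : Integrable (fun S : Fin m → Z => Real.log (hessianDet (fun h => empLoss ℓ h S) x))
      (Measure.pi fun _ : Fin m => D)) :
    expNegLogDet D (fun z => hessianMatrix (fun h => ℓ h z) x) m ≠ ⊤ := by
  refine ((lintegral_mono fun S => ?_).trans_lt hint.abs.lintegral_lt_top).ne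
  exact ENNReal.ofReal_le_ofReal (negLogDet_le_abs_log_hessianDet hsmooth hm S)

theorem neg_expNegLogDet_le_integral {D : Measure Z} [IsProbabilityMeasure D]
    (hℓ : ∀ h, Measurable (ℓ h)) (hsmooth : ∀ z, ContDiff ℝ 2 fun h => ℓ h z)
    {m : ℕ} (hm : 0 < m)
    (hint : Integrable (fun S : Fin m → Z => Real.log (hessianDet (fun h => empLoss ℓ h S) x))
      (Measure.pi fun _ : Fin m => D)) :
    -((expNegLogDet D (fun z => hessianMatrix (fun h => ℓ h z) x) m).toReal + d * Real.log m) ≤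
      ∫ S, Real.log (hessianDet (fun h => empLoss ℓ h S) x) ∂(Measure.pi fun _ : Fin m => D) := by
  have hmeas : Measurable fun S : Fin m → Z =>
      negLogDet (∑ j, hessianMatrix (fun h => ℓ h (S j)) x) :=
    measurable_negLogDet (measurable_sum_entries (measurable_hessianMatrix hℓ hsmooth) (Fin m))
  have hi : Integrable (fun S : Fin m → Z =>
      negLogDet (∑ j, hessianMatrix (fun h => ℓ h (S j)) x)) (Measure.pi fun _ : Fin m => D) :=
    hint.abs.mono' hmeas.aestronglyMeasurable (ae_of_all _ fun S => by
      rw [Real.norm_eq_abs, abs_of_nonneg (negLogDet_nonneg _)]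
      exact negLogDet_le_abs_log_hessianDet hsmooth hm S)
  have h1 : (expNegLogDet D (fun z => hessianMatrix (fun h => ℓ h z) x) m).toReal =
      ∫ S, negLogDet (∑ j, hessianMatrix (fun h => ℓ h (S j)) x)
        ∂(Measure.pi fun _ : Fin m => D) :=
    (integral_eq_lintegral_of_nonneg_ae (ae_of_all _ fun _ => negLogDet_nonneg _)
      hmeas.aestronglyMeasurable).symm
  have h2 : ∫ S, -(negLogDet (∑ j, hessianMatrix (fun h => ℓ h (S j)) x) + d * Real.log m)
      ∂(Measure.pi fun _ : Fin m => D) =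
      -((expNegLogDet D (fun z => hessianMatrix (fun h => ℓ h z) x) m).toReal +
        d * Real.log m) := by
    rw [integral_neg, integral_add hi (integrable_const _), h1]
    simp
  rw [← h2]
  exact integral_mono (hi.add (integrable_const _)).neg hint
    (neg_le_log_hessianDet hsmooth hm)

theorem limit_log_hessianDet_nonneg (hℓ : ∀ h, Measurable (ℓ h))
    (hsmooth : ∀ z, ContDiff ℝ 2 fun h => ℓ h z) {T : ℕ} (hT : 2 ≤ T) (D : ℕ → Measure Z)
    (hD : ∀ j < T, IsProbabilityMeasure (D j)) (hstar : ℕ → Fin d → ℝ)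
    (hpos : ∀ k < T - 1, ∀ z, (hessianMatrix (fun h => ℓ h z) (hstar k)).PosSemidef) {C : ℝ}
    (hC : Tendsto (fun m : ℕ =>
      (1 / (2 * Real.sqrt m * ((T : ℝ) - 1))) *
        ∫ ω, (∑ k ∈ Finset.univ.filter (fun k : Fin T => (k : ℕ) < T - 1),
            Real.log (hessianDet (fun h => empLoss ℓ h (ω k)) (hstar (k : ℕ))))
          ∂(Measure.pi fun k : Fin T => Measure.pi fun _ : Fin m => D (k : ℕ)))
      atTop (nhds C)) : 0 ≤ C := by
  have : ∀ k : Fin T, IsProbabilityMeasure (D k) := fun k => hD k k.2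
  have hT' : (0 : ℝ) < T - 1 := by
    have : (2 : ℝ) ≤ T := by exact_mod_cast hT
    linarith
  set I := Finset.univ.filter fun k : Fin T => (k : ℕ) < T - 1 with hI
  have hIpos : ∀ k ∈ I, ∀ z, (hessianMatrix (fun h => ℓ h z) (hstar (k : ℕ))).PosSemidef :=
    fun k hk => hpos k (Finset.mem_filter.1 hk).2
  by_cases hfreq : ∃ᶠ m : ℕ in atTop, ¬Integrable (fun ω : Fin T → Fin m → Z =>
      ∑ k ∈ I, Real.log (hessianDet (fun h => empLoss ℓ h (ω k)) (hstar (k : ℕ))))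
      (Measure.pi fun k : Fin T => Measure.pi fun _ : Fin m => D (k : ℕ))
  · by_contra! hneg
    refine hfreq ?_
    filter_upwards [hC.eventually_ne hneg.ne] with m hm hni
    exact hm (by rw [integral_undef hni, mul_zero])
  have hint : ∀ᶠ m : ℕ in atTop, ∀ k ∈ I, Integrable (fun S : Fin m → Z =>
      Real.log (hessianDet (fun h => empLoss ℓ h S) (hstar (k : ℕ))))
      (Measure.pi fun _ : Fin m => D (k : ℕ)) := by
    rw [not_frequently] at hfreq
    filter_upwards [hfreq] with m hm k hk
    rw [not_not] at hm
    exact integrable_of_integrable_sum_pi (F := fun (k : Fin T) (S : Fin m → Z) =>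
      Real.log (hessianDet (fun h => empLoss ℓ h S) (hstar (k : ℕ)))) hm hk
  set e : Fin T → ℕ → ENNReal := fun k m =>
    expNegLogDet (D k) (fun z => hessianMatrix (fun h => ℓ h z) (hstar k)) m with he
  have hk₀ : ∀ k ∈ I, ∃ k₀ : ℕ, 0 < k₀ ∧ ∀ n, 0 < n → k₀ ∣ n →
      Tendsto (fun r : ℕ => (e k (r * n)).toReal / √r) atTop (nhds 0) := fun k hk => by
    refine exists_tendsto_expNegLogDet_mul_div_sqrt (measurable_hessianMatrix hℓ hsmooth)
      (hIpos k hk) ?_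
    filter_upwards [hint, eventually_gt_atTop 0] with m hm hm0
    exact expNegLogDet_ne_top_of_integrable hsmooth hm0 (hm k hk)
  choose! k₀ hk₀pos hk₀ using hk₀
  set n := ∏ k ∈ I, k₀ k with hn
  have hn0 : 0 < n := Finset.prod_pos hk₀pos
  have hn0' : (0 : ℝ) < n := by exact_mod_cast hn0
  have hsub : Tendsto (fun r : ℕ => r * n) atTop atTop :=
    tendsto_id.atTop_mul_const' hn0
  have hlog : Tendsto (fun m : ℕ => Real.log m / √m) atTop (nhds 0) := by
    have := (isLittleO_log_rpow_atTop (r := 1 / 2) (by norm_num)).tendsto_div_nhds_zero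
    simpa only [Function.comp_def, ← Real.sqrt_eq_rpow] using
      this.comp tendsto_natCast_atTop_atTop
  have hE : ∀ k ∈ I, Tendsto (fun r : ℕ => (e k (r * n)).toReal / √((r * n : ℕ) : ℝ)) atTop
      (nhds 0) := fun k hk => by
    have := (hk₀ k hk n hn0 (Finset.dvd_prod_of_mem k₀ hk)).div_const √(n : ℝ)
    rw [zero_div] at this
    refine this.congr fun r => ?_
    rw [Nat.cast_mul, Real.sqrt_mul (Nat.cast_nonneg r), div_div]
  have hlower : Tendsto (fun r : ℕ => -(1 / (2 * ((T : ℝ) - 1)) * ∑ k ∈ I,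
      ((e k (r * n)).toReal / √((r * n : ℕ) : ℝ) +
        d * (Real.log (r * n : ℕ) / √((r * n : ℕ) : ℝ))))) atTop (nhds 0) := by
    have := ((tendsto_finsetSum I fun k hk =>
      (hE k hk).add ((hlog.comp hsub).const_mul (d : ℝ))).const_mul (1 / (2 * ((T : ℝ) - 1)))).neg
    simpa using this
  refine le_of_tendsto_of_tendsto hlower (hC.comp hsub) ?_
  filter_upwards [hsub.eventually hint, hsub.eventually (eventually_gt_atTop 0)] with r hr hr0
  simp only [Function.comp_apply]
  set m := r * n with hm
  have hm' : (0 : ℝ) < √(m : ℝ) := Real.sqrt_pos.2 (by exact_mod_cast hr0)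
  have hmp (k : Fin T) := measurePreserving_eval
    (fun k : Fin T => Measure.pi fun _ : Fin m => D (k : ℕ)) k
  have hsum : ∫ ω, (∑ k ∈ I, Real.log (hessianDet (fun h => empLoss ℓ h (ω k)) (hstar (k : ℕ))))
      ∂(Measure.pi fun k : Fin T => Measure.pi fun _ : Fin m => D (k : ℕ)) =
      ∑ k ∈ I, ∫ S, Real.log (hessianDet (fun h => empLoss ℓ h S) (hstar (k : ℕ)))
        ∂(Measure.pi fun _ : Fin m => D (k : ℕ)) := by
    rw [integral_finsetSum (f := fun (k : Fin T) (ω : Fin T → Fin m → Z) =>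
      Real.log (hessianDet (fun h => empLoss ℓ h (ω k)) (hstar (k : ℕ)))) I fun k hk =>
        (hmp k).integrable_comp_of_integrable (hr k hk)]
    refine Finset.sum_congr rfl fun k hk => ?_
    have := integral_map (hmp k).aemeasurable (f := fun S : Fin m → Z =>
      Real.log (hessianDet (fun h => empLoss ℓ h S) (hstar (k : ℕ))))
      (by rw [(hmp k).map_eq]; exact (hr k hk).aestronglyMeasurable)
    rw [(hmp k).map_eq] at this
    exact this.symm
  rw [hsum]
  calc -(1 / (2 * ((T : ℝ) - 1)) * ∑ k ∈ I, ((e k m).toReal / √(m : ℝ) +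
        d * (Real.log m / √(m : ℝ))))
      = (1 / (2 * √(m : ℝ) * ((T : ℝ) - 1))) *
          ∑ k ∈ I, -((e k m).toReal + d * Real.log m) := by
        rw [Finset.sum_neg_distrib, mul_neg, Finset.mul_sum, Finset.mul_sum]
        congr 1
        refine Finset.sum_congr rfl fun k _ => ?_
        field_simp
    _ ≤ _ := by
        refine mul_le_mul_of_nonneg_left (Finset.sum_le_sum fun k hk => ?_) (by positivity)
        exact neg_expNegLogDet_le_integral hℓ hsmooth hr0 (hr k hk)

end

section
variable {H Z : Type*} [MeasurableSpace H] [TopologicalSpace H] [FirstCountableTopology H]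
  [MeasurableSpace Z] {ℓ : H → Z → ℝ} {K : ℝ}

theorem continuous_expLoss (hℓ : Measurable (Function.uncurry ℓ))
    (hb : ∀ h z, ℓ h z ∈ Set.Icc 0 K) (hcont : ∀ z, Continuous fun h => ℓ h z)
    (D : Measure Z) [IsFiniteMeasure D] : Continuous fun h => expLoss ℓ h D :=
  continuous_of_dominated (bound := fun _ => K)
    (fun h => (hℓ.comp measurable_prodMk_left).aestronglyMeasurable)
    (fun h => ae_of_all _ fun z => by
      rw [Real.norm_eq_abs, abs_of_nonneg (hb h z).1]; exact (hb h z).2)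
    (integrable_const K) (ae_of_all _ hcont)

variable [HereditarilyLindelofSpace H] [OpensMeasurableSpace H]

/-- Under nonnegative task covariance, the minimizer of the expected loss of task `i` minimizes
the loss on every single data point. -/
theorem loss_le_of_mem_support {P : Measure H} [IsProbabilityMeasure P]
    (hℓ : Measurable (Function.uncurry ℓ)) (hb : ∀ h z, ℓ h z ∈ Set.Icc 0 K)
    (hcont : ∀ z, Continuous fun h => ℓ h z) (hsupp : IsCompact P.support) {T : ℕ} (hT : 0 < T)
    (i : Fin (T + 1)) (D : Measure Z) [IsProbabilityMeasure D] {x : H} (hx : x ∈ P.support)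
    (hxmin : ∀ h ∈ P.support, h ≠ x → expLoss ℓ x D < expLoss ℓ h D)
    (hcov : ∀ (m : ℕ), 0 < m → ∀ ω : Fin (T + 1) → Fin m → Z,
      0 ≤ (∫ h, Real.exp (-(Real.sqrt m * empLoss ℓ h (ω i))) *
            Real.exp (-(Real.sqrt m * ∑ k ∈ Finset.univ.erase i, empLoss ℓ h (ω k))) ∂P) -
        (∫ h, Real.exp (-(Real.sqrt m * empLoss ℓ h (ω i))) ∂P) *
          ∫ h, Real.exp (-(Real.sqrt m * ∑ k ∈ Finset.univ.erase i, empLoss ℓ h (ω k))) ∂P)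
    (z : Z) : ∀ h ∈ P.support, ℓ x z ≤ ℓ h z := by
  have hT' : (0 : ℝ) < T := by exact_mod_cast hT
  refine le_of_integral_exp_mul_integral_exp_le (hcont z)
    ((continuous_expLoss hℓ hb hcont D).const_mul (T : ℝ)) (fun h => (hb h z).1)
    (fun h => mul_nonneg hT'.le (expLoss_mem_Icc hb hℓ D h).1) hsupp hx
    (fun h hh hne => mul_lt_mul_of_pos_left (hxmin h hh hne) hT')
    (Real.tendsto_sqrt_atTop.comp tendsto_natCast_atTop_atTop)
    (C := Real.exp ((T : ℝ) ^ 2 * K ^ 2 / 8)) ?_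
  filter_upwards [eventually_gt_atTop 0] with m hm
  refine integral_exp_mul_integral_exp_expLoss_le hℓ hb hm D (hcont z).measurable
    (fun h => (hb h z).1) hT'.le fun S => ?_
  have h1 := hcov m hm (Function.update (fun _ => S) i fun _ => z)
  have hm' : (m : ℝ) ≠ 0 := by exact_mod_cast hm.ne'
  have h2 : ∀ h, empLoss ℓ h (fun _ : Fin m => z) = ℓ h z := fun h => by
    simp [empLoss, hm']
  have h3 : ∀ h, ∑ k ∈ Finset.univ.erase i,
      empLoss ℓ h (Function.update (fun _ => S) i (fun _ => z) k) = T * empLoss ℓ h S := fun h => by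
    rw [sum_erase_eq_sum_succAbove]
    simp
  simp only [Function.update_self, h2, h3] at h1
  linarith

end

/-- Theorem (asymptotic oracle bound for related tasks, tasks indexed `0,…,T−1`).
Fix `T ≥ 2` tasks; `Hset ⊆ ℝ^d` compact bounded, `P` the uniform probability measure on `Hset`;
the loss is `[0,K]`-bounded and `C²` in `h`; each `L(·, D_i)` (for previous tasks `i < T−1`)
has a unique global minimizer `h*_i` in the interior of `Hset`; the empirical task covariance
`cov_{h∼P}(e^{−√m L̂(h,S_i)}, e^{−√m ∑_{j≠i} L̂(h,S_j)})` is nonnegative for every realization.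
With the `T`-fold iterated empirical Gibbs posterior at temperature `√m`, provided the limits
exist,
`lim_m (1/(T−1)) E ∑_{i<T−1} L(Q̂^{√m}_{1:T}, D_i)
  ≤ (1/(T−1)) ∑_{i<T−1} L(h*_i, D_i)
    + lim_m (1/(2√m(T−1))) E ∑_{i<T−1} log det ∇²_h L̂(·,S_i)(h*_i)`. -/
theorem asymptotic_gibbs_forgetting_related_tasks {Z : Type*} [MeasurableSpace Z] (d : ℕ)
    (Hset : Set (Fin d → ℝ)) (hHcompact : IsCompact Hset) (hHbounded : Bornology.IsBounded Hset)
    (hHvol : 0 < MeasureTheory.volume Hset)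
    (ℓ : (Fin d → ℝ) → Z → ℝ) (hℓ : Measurable (Function.uncurry ℓ))
    (K : ℝ) (hb : ∀ h z, ℓ h z ∈ Set.Icc 0 K)
    (hsmooth : ∀ z, ContDiff ℝ 2 fun h => ℓ h z)
    (T : ℕ) (hT : 2 ≤ T)
    (D : ℕ → Measure Z) (hD : ∀ j < T, IsProbabilityMeasure (D j))
    (P : Measure (Fin d → ℝ))
    (hP : P = (MeasureTheory.volume Hset)⁻¹ • MeasureTheory.volume.restrict Hset)
    (hstar : ℕ → (Fin d → ℝ))
    (hstar_mem : ∀ i < T - 1, hstar i ∈ interior Hset)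
    (hstar_min : ∀ i < T - 1, ∀ h' ∈ Hset, h' ≠ hstar i →
      expLoss ℓ (hstar i) (D i) < expLoss ℓ h' (D i))
    (hcov : ∀ (m : ℕ), 0 < m → ∀ (ω : Fin T → Fin m → Z), ∀ i, ∀ hi : i < T - 1,
      0 ≤ (∫ h, Real.exp (-(Real.sqrt m * empLoss ℓ h (ω ⟨i, by omega⟩))) *
            Real.exp (-(Real.sqrt m *
              ∑ k ∈ Finset.univ.erase (⟨i, by omega⟩ : Fin T), empLoss ℓ h (ω k))) ∂P) -
        (∫ h, Real.exp (-(Real.sqrt m * empLoss ℓ h (ω ⟨i, by omega⟩))) ∂P) *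
          ∫ h, Real.exp (-(Real.sqrt m *
            ∑ k ∈ Finset.univ.erase (⟨i, by omega⟩ : Fin T), empLoss ℓ h (ω k))) ∂P)
    (A C : ℝ)
    (hA : Tendsto (fun m : ℕ =>
      (1 / ((T : ℝ) - 1)) *
        ∫ ω, (∑ i ∈ Finset.range (T - 1),
            ∫ h, expLoss ℓ h (D i)
              ∂(iterGibbs P (fun j h => if hj : j < T then
                  Real.sqrt m * empLoss ℓ h (ω ⟨j, hj⟩) else 0) T))
          ∂(Measure.pi fun k : Fin T => Measure.pi fun _ : Fin m => D (k : ℕ)))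
      atTop (nhds A))
    (hC : Tendsto (fun m : ℕ =>
      (1 / (2 * Real.sqrt m * ((T : ℝ) - 1))) *
        ∫ ω, (∑ k ∈ Finset.univ.filter (fun k : Fin T => (k : ℕ) < T - 1),
            Real.log (hessianDet (fun h => empLoss ℓ h (ω k)) (hstar (k : ℕ))))
          ∂(Measure.pi fun k : Fin T => Measure.pi fun _ : Fin m => D (k : ℕ)))
      atTop (nhds C)) :
    A ≤ (1 / ((T : ℝ) - 1)) * (∑ i ∈ Finset.range (T - 1), expLoss ℓ (hstar i) (D i)) + C := by
  have hmeas : ∀ h, Measurable (ℓ h) := fun h => hℓ.comp measurable_prodMk_left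
  have hcont : ∀ z, Continuous fun h => ℓ h z := fun z => (hsmooth z).continuous
  have hPprob : IsProbabilityMeasure P := by
    refine ⟨?_⟩
    rw [hP, Measure.smul_apply, Measure.restrict_apply_univ, smul_eq_mul]
    exact ENNReal.inv_mul_cancel hHvol.ne' hHcompact.measure_lt_top.ne
  have hsub : P.support ⊆ Hset := by
    refine Measure.support_subset_of_isClosed hHcompact.isClosed ?_
    rw [hP]
    exact Measure.ae_smul_measure (ae_restrict_mem hHcompact.measurableSet) _
  have hint : interior Hset ⊆ P.support := by
    intro x hx
    rw [Measure.mem_support_iff_forall]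
    intro U hU
    have h1 : 0 < volume (U ∩ interior Hset) :=
      Measure.measure_pos_of_mem_nhds _ (Filter.inter_mem hU (isOpen_interior.mem_nhds hx))
    have h2 : 0 < volume (U ∩ Hset) :=
      h1.trans_le (measure_mono (Set.inter_subset_inter_right _ interior_subset))
    rw [hP, Measure.smul_apply, Measure.restrict_apply' hHcompact.measurableSet, smul_eq_mul]
    exact ENNReal.mul_pos (ENNReal.inv_ne_zero.2 hHcompact.measure_lt_top.ne) h2.ne'
  have hsupp : IsCompact P.support := hHcompact.of_isClosed_subset Measure.isClosed_support hsub
  have hA' := limit_expected_risk_le hℓ hb hT D hD hstar (fun i hi ε hε => by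
    have := hD i (by omega)
    exact ((Measure.mem_support_iff_forall _).1 (hint (hstar_mem i hi)) _
      ((continuous_expLoss hℓ hb hcont (D i)).continuousAt.eventually_lt_const
        (lt_add_of_pos_right _ hε))).ne') hcov hA
  have hC' : 0 ≤ C := by
    refine limit_log_hessianDet_nonneg hmeas hsmooth hT D hD hstar (fun i hi z => ?_) hC
    obtain ⟨T, rfl⟩ : ∃ n, T = n + 1 := ⟨T - 1, by omega⟩
    have := hD i (by omega)
    refine posSemidef_hessianMatrix_of_isLocalMin (hsmooth z) ?_
    filter_upwards [isOpen_interior.mem_nhds (hstar_mem i hi)] with h hh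
    exact loss_le_of_mem_support hℓ hb hcont hsupp (by omega) ⟨i, by omega⟩ (D i)
      (hint (hstar_mem i hi)) (fun h hh => hstar_min i hi h (hsub hh))
      (fun m hm ω => hcov m hm ω i hi) z h (hint hh)
  linarith
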